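/- arXiv:1909.05292 — 4 statements merged into one kernel-verified Lean document; each statement's English description precedes it below -/
import Mathlib

section
/- Let E be the sapphire group determined by integers r, s, t, u with ru − st = 1 and rstu ≠ 0, and let Aut₀(E) be the subgroup of Aut(E) consisting of those automorphisms φ such that φ maps the subgroup ⟨d, b⟩ onto itself and φ(v) ∈ ⟨d, b⟩·v. Then Aut₀(E) is a normal subgroup of index 2 in Aut(E), and the short exact sequence 1 → Aut₀(E) → Aut(E) → ℤ/2 → 1 splits: there exists ζ ∈ Aut(E) with ζ ∉ Aut₀(E) and ζ² = id. Consequently Aut(E) is isomorphic to a semidirect product Aut₀(E) ⋊ ℤ/2, hence to an iterated semidirect product (((ℤ × ℤ) ⋊ ℤ/2) ⋊ ℤ) ⋊ ℤ/2, where the nontrivial element of the inner ℤ/2 acts on ℤ × ℤ by multiplication by −1. -/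
open Matrix SemidirectProduct Multiplicative

abbrev GL2Z := GL (Fin 2) ℤ

/-- The defining relations of the sapphire group determined by `r, s, t, u`, on the four
generators `d = 0`, `b = 1`, `v = 2`, `a = 3`. -/
def sapphireRels (r s t u : ℤ) : Set (FreeGroup (Fin 4)) :=
  { FreeGroup.of 0 * FreeGroup.of 1 * (FreeGroup.of 0)⁻¹ * (FreeGroup.of 1)⁻¹,
    FreeGroup.of 2 * FreeGroup.of 0 * (FreeGroup.of 2)⁻¹ *
      (FreeGroup.of 0 ^ (r * u + s * t) * FreeGroup.of 1 ^ (-(2 * s * u)))⁻¹,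
    FreeGroup.of 2 * FreeGroup.of 1 * (FreeGroup.of 2)⁻¹ *
      (FreeGroup.of 0 ^ (-(2 * r * t)) * FreeGroup.of 1 ^ (r * u + s * t))⁻¹,
    FreeGroup.of 3 ^ 2 * (FreeGroup.of 0)⁻¹,
    FreeGroup.of 3 * FreeGroup.of 1 * (FreeGroup.of 3)⁻¹ * FreeGroup.of 1,
    FreeGroup.of 3 * FreeGroup.of 2 * (FreeGroup.of 3)⁻¹ *
      (FreeGroup.of 0 ^ (r - r * u - s * t) * FreeGroup.of 1 ^ (s - 2 * s * u) *
        (FreeGroup.of 2)⁻¹)⁻¹ }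

/-- The sapphire group: the fundamental group of the sapphire Sol 3-manifold determined by the
matrix `[[r, s], [t, u]]`. -/
abbrev Sapphire (r s t u : ℤ) : Type := PresentedGroup (sapphireRels r s t u)

/-- The generator `d` of the sapphire group. -/
def sapd (r s t u : ℤ) : Sapphire r s t u := PresentedGroup.of 0

/-- The generator `b` of the sapphire group. -/
def sapb (r s t u : ℤ) : Sapphire r s t u := PresentedGroup.of 1

/-- The generator `v` of the sapphire group. -/
def sapv (r s t u : ℤ) : Sapphire r s t u := PresentedGroup.of 2

/-- The generator `a` of the sapphire group. -/
def sapa (r s t u : ℤ) : Sapphire r s t u := PresentedGroup.of 3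

/-- The subgroup `⟨d, b⟩` of the sapphire group. -/
def sapDB (r s t u : ℤ) : Subgroup (Sapphire r s t u) :=
  Subgroup.closure {sapd r s t u, sapb r s t u}

lemma mem_of_map_eq {G : Type*} [Group G] {K : Subgroup G} {φ : MulAut G}
    (h : K.map φ.toMonoidHom = K) {g : G} (hg : g ∈ K) : φ g ∈ K := by
  rw [← h]; exact ⟨g, hg, rfl⟩

lemma map_inv_eq_of_map_eq {G : Type*} [Group G] {K : Subgroup G} {φ : MulAut G}
    (h : K.map φ.toMonoidHom = K) : K.map (φ⁻¹ : MulAut G).toMonoidHom = K := by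
  conv_lhs => rw [← h]
  rw [Subgroup.map_map]
  have hid : ((φ⁻¹ : MulAut G).toMonoidHom.comp φ.toMonoidHom) = MonoidHom.id G := by
    refine MonoidHom.ext fun x => ?_
    show (φ⁻¹ : MulAut G) (φ x) = x
    simp
  rw [hid, Subgroup.map_id]

/-- The subgroup `Aut₀(E)` of automorphisms of the sapphire group mapping `⟨d, b⟩` onto itself
and with `φ(v) ∈ ⟨d, b⟩ · v`. -/
def sapAut₀ (r s t u : ℤ) : Subgroup (MulAut (Sapphire r s t u)) where
  carrier := {φ | (sapDB r s t u).map φ.toMonoidHom = sapDB r s t u ∧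
    ∃ g ∈ sapDB r s t u, φ (sapv r s t u) = g * sapv r s t u}
  one_mem' := by
    refine ⟨?_, 1, one_mem _, by simp⟩
    have : ((1 : MulAut (Sapphire r s t u)).toMonoidHom) = MonoidHom.id _ := rfl
    rw [this, Subgroup.map_id]
  mul_mem' := by
    intro x y hx hy
    obtain ⟨hx1, gx, hgx, hgxv⟩ := hx
    obtain ⟨hy1, gy, hgy, hgyv⟩ := hy
    have hmap : ((x * y : MulAut (Sapphire r s t u)).toMonoidHom)
        = x.toMonoidHom.comp y.toMonoidHom := rfl
    refine ⟨by rw [hmap, ← Subgroup.map_map, hy1, hx1], x gy * gx, ?_, ?_⟩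
    · exact mul_mem (mem_of_map_eq hx1 hgy) hgx
    · have : (x * y : MulAut (Sapphire r s t u)) (sapv r s t u) = x (y (sapv r s t u)) := rfl
      rw [this, hgyv, _root_.map_mul, hgxv, ← mul_assoc]
  inv_mem' := by
    intro x hx
    obtain ⟨hx1, g, hg, hgv⟩ := hx
    refine ⟨map_inv_eq_of_map_eq hx1, ((x⁻¹ : MulAut (Sapphire r s t u)) g)⁻¹,
      inv_mem (mem_of_map_eq (map_inv_eq_of_map_eq hx1) hg), ?_⟩
    have h1 : (x⁻¹ : MulAut (Sapphire r s t u)) (x (sapv r s t u)) = sapv r s t u := by simp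
    rw [hgv, _root_.map_mul] at h1
    rw [eq_inv_mul_iff_mul_eq, h1]

/-- A subgroup and a subgroup normalising it with trivial intersection generate a semidirect
product, whose elements are the products of elements of the two. -/
lemma exists_semidirectProduct_hom {G N C : Type*} [Group G] [Group N] [Group C] {i : N →* G}
    (hi : Function.Injective i) (σ : C →* G) (hn : ∀ c n, ∃ n', i n' = σ c * i n * (σ c)⁻¹)
    (hdis : ∀ c, σ c ∈ i.range → c = 1) :
    ∃ ψ : C →* MulAut N, (∀ c n, i (ψ c n) = σ c * i n * (σ c)⁻¹) ∧
      ∃ j : N ⋊[ψ] C →* G, Function.Injective j ∧ ∀ x, j x = i x.left * σ x.right := by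
  choose f hf using hn
  let F : C → MulAut N := fun c =>
    { toFun := f c
      invFun := f c⁻¹
      left_inv := fun n => hi (by rw [hf, hf, map_inv]; group)
      right_inv := fun n => hi (by rw [hf, hf, map_inv]; group)
      map_mul' := fun n n' => hi (by rw [hf, map_mul, map_mul, hf, hf]; group) }
  let ψ : C →* MulAut N := MonoidHom.mk' F fun c c' => MulEquiv.ext fun n => hi <| by
    change i (f (c * c') n) = i (f c (f c' n))
    rw [hf, hf, hf, map_mul]; group
  have hψ : ∀ c n, i (ψ c n) = σ c * i n * (σ c)⁻¹ := hf
  refine ⟨ψ, hψ, SemidirectProduct.lift i σ fun c => MonoidHom.ext fun n => hψ c n, ?_,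
    fun x => rfl⟩
  refine (injective_iff_map_eq_one _).2 fun x hx => ?_
  have hx : i x.left * σ x.right = 1 := hx
  have hr : x.right = 1 := hdis _ ⟨x.left⁻¹, by
    rw [map_inv, inv_eq_iff_mul_eq_one, hx]⟩
  rw [hr, map_one, mul_one] at hx
  exact SemidirectProduct.ext (hi (hx.trans (map_one i).symm)) hr

/-- Adjoining an involution to a subgroup that it normalises. -/
lemma exists_semidirectProduct_zmod_two {G N : Type*} [Group G] [Group N] {i : N →* G}
    (hi : Function.Injective i) {τ : G} (hτ : τ * τ = 1) (hτi : τ ∉ i.range)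
    (hn : ∀ n, ∃ n', i n' = τ * i n * τ⁻¹) :
    ∃ ψ : Multiplicative (ZMod 2) →* MulAut N, (∀ n, i (ψ (ofAdd 1) n) = τ * i n * τ⁻¹) ∧
      ∃ j : N ⋊[ψ] Multiplicative (ZMod 2) →* G, Function.Injective j ∧
        ∀ g, g ∈ j.range ↔ g ∈ i.range ∨ g * τ ∈ i.range := by
  obtain ⟨σ, hσ⟩ : ∃ σ : Multiplicative (ZMod 2) →* G, σ (ofAdd 1) = τ := by
    let f : ZMod 2 →+ Additive G := ZMod.lift 2 ⟨zmultiplesHom _ (Additive.ofMul τ), by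
      simpa [two_zsmul, ← ofMul_mul] using hτ⟩
    refine ⟨AddMonoidHom.toMultiplicativeLeft f, ?_⟩
    have : f ((1 : ℤ) : ZMod 2) = Additive.ofMul τ := by
      rw [ZMod.lift_coe]; simp
    rw [Int.cast_one] at this
    exact this
  have hcases : ∀ c : Multiplicative (ZMod 2), c = 1 ∨ c = ofAdd 1 := by decide
  obtain ⟨ψ, hψ, j, hj, hji⟩ := exists_semidirectProduct_hom hi σ
    (fun c n => by
      rcases hcases c with rfl | rfl
      · exact ⟨n, by simp⟩
      · rw [hσ]; exact hn n)
    (fun c hc => (hcases c).resolve_right fun h => hτi (by rwa [h, hσ] at hc))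
  refine ⟨ψ, fun n => by rw [hψ, hσ], j, hj, fun g => ⟨?_, ?_⟩⟩
  · rintro ⟨x, rfl⟩
    rw [hji]
    rcases hcases x.right with h | h
    · exact .inl ⟨x.left, by rw [h, map_one, mul_one]⟩
    · exact .inr ⟨x.left, by rw [h, hσ, mul_assoc, hτ, mul_one]⟩
  · rintro (⟨n, rfl⟩ | ⟨n, hn⟩)
    · exact ⟨⟨n, 1⟩, by simp [hji]⟩
    · exact ⟨⟨n, ofAdd 1⟩, by simp [hji, hσ, hn, mul_assoc, hτ]⟩

/-- Adjoining an element of infinite order to a subgroup that it normalises. -/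
lemma exists_semidirectProduct_int {G N : Type*} [Group G] [Group N] {i : N →* G}
    (hi : Function.Injective i) (σ : G) (hσ : ∀ k : ℤ, σ ^ k ∈ i.range → k = 0)
    (hn : ∀ (k : ℤ) n, ∃ n', i n' = σ ^ k * i n * (σ ^ k)⁻¹) :
    ∃ ψ : Multiplicative ℤ →* MulAut N, ∃ j : N ⋊[ψ] Multiplicative ℤ →* G,
      Function.Injective j ∧ ∀ g, g ∈ j.range ↔ ∃ k : ℤ, g * σ ^ k ∈ i.range := by
  obtain ⟨ψ, hψ, j, hj, hji⟩ := exists_semidirectProduct_hom hi (zpowersHom G σ)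
    (fun c n => hn c.toAdd n) (fun c hc => hσ c.toAdd hc)
  refine ⟨ψ, j, hj, fun g => ⟨?_, ?_⟩⟩
  · rintro ⟨x, rfl⟩
    exact ⟨-x.right.toAdd, x.left, by rw [hji]; simp⟩
  · rintro ⟨k, n, hn⟩
    exact ⟨⟨n, ofAdd (-k)⟩, by rw [hji]; simp [hn]⟩

/-- A group is the semidirect product of a subgroup of index two and an involution outside it. -/
lemma exists_mulEquiv_semidirectProduct_zmod_two {G N : Type*} [Group G] [Group N] {i : N →* G}
    (hi : Function.Injective i) {τ : G} (hτ : τ * τ = 1) (hτi : τ ∉ i.range)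
    (hmul : ∀ g, g ∉ i.range → g * τ ∈ i.range) (hn : i.range.Normal) :
    ∃ ψ : Multiplicative (ZMod 2) →* MulAut N,
      Nonempty (G ≃* N ⋊[ψ] Multiplicative (ZMod 2)) := by
  obtain ⟨ψ, -, j, hj, hjr⟩ := exists_semidirectProduct_zmod_two hi hτ hτi
    fun n => hn.conj_mem _ ⟨n, rfl⟩ τ
  have hsurj : Function.Surjective j := fun g => (hjr g).2 (or_iff_not_imp_left.2 (hmul g))
  exact ⟨ψ, ⟨(MulEquiv.ofBijective j ⟨hj, hsurj⟩).symm⟩⟩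

section Model

variable {r s t u : ℤ}

lemma Sapphire.hom_ext {H : Type*} [Group H] {f g : Sapphire r s t u →* H}
    (hd : f (sapd r s t u) = g (sapd r s t u)) (hb : f (sapb r s t u) = g (sapb r s t u))
    (hv : f (sapv r s t u) = g (sapv r s t u)) (ha : f (sapa r s t u) = g (sapa r s t u)) :
    f = g := by
  refine PresentedGroup.ext fun x => ?_
  fin_cases x
  exacts [hd, hb, hv, ha]

/-- The homomorphism out of the sapphire group given by images of the generators satisfying the
defining relations. -/
lemma Sapphire.exists_hom {H : Type*} [Group H] (d b v a : H) (hdb : d * b = b * d)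
    (hvd : v * d * v⁻¹ = d ^ (r * u + s * t) * b ^ (-(2 * s * u)))
    (hvb : v * b * v⁻¹ = d ^ (-(2 * r * t)) * b ^ (r * u + s * t))
    (had : a ^ 2 = d) (hab : a * b * a⁻¹ = b⁻¹)
    (hav : a * v * a⁻¹ = d ^ (r - r * u - s * t) * b ^ (s - 2 * s * u) * v⁻¹) :
    ∃ f : Sapphire r s t u →* H, f (sapd r s t u) = d ∧ f (sapb r s t u) = b ∧
      f (sapv r s t u) = v ∧ f (sapa r s t u) = a := by
  have h : ∀ x ∈ sapphireRels r s t u, FreeGroup.lift ![d, b, v, a] x = 1 := by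
    rintro x (rfl | rfl | rfl | rfl | rfl | rfl)
    · simp [hdb]
    · simp only [map_mul, map_inv, map_zpow, FreeGroup.lift_apply_of]
      exact mul_inv_eq_one.2 hvd
    · simp only [map_mul, map_inv, map_zpow, FreeGroup.lift_apply_of]
      exact mul_inv_eq_one.2 hvb
    · simp only [map_mul, map_inv, map_pow, FreeGroup.lift_apply_of]
      exact mul_inv_eq_one.2 had
    · simp only [map_mul, map_inv, FreeGroup.lift_apply_of]
      exact mul_eq_one_iff_eq_inv.2 hab
    · simp only [map_mul, map_inv, map_zpow, FreeGroup.lift_apply_of]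
      exact mul_inv_eq_one.2 hav
  exact ⟨PresentedGroup.toGroup h, PresentedGroup.toGroup.of h, PresentedGroup.toGroup.of h,
    PresentedGroup.toGroup.of h, PresentedGroup.toGroup.of h⟩

lemma sapd_mul_sapb : sapd r s t u * sapb r s t u = sapb r s t u * sapd r s t u := by
  have := PresentedGroup.one_of_mem (rels := sapphireRels r s t u) (Set.mem_insert _ _)
  rw [map_mul, map_inv, mul_inv_eq_one, map_mul, map_inv, mul_inv_eq_iff_eq_mul] at this
  exact this

lemma sapv_conj_sapd : sapv r s t u * sapd r s t u * (sapv r s t u)⁻¹ =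
    sapd r s t u ^ (r * u + s * t) * sapb r s t u ^ (-(2 * s * u)) := by
  have := PresentedGroup.one_of_mem (rels := sapphireRels r s t u)
    (.inr (.inl rfl))
  rw [map_mul, map_inv, mul_inv_eq_one] at this
  simp only [map_mul, map_zpow, map_inv] at this
  exact this

lemma sapv_conj_sapb : sapv r s t u * sapb r s t u * (sapv r s t u)⁻¹ =
    sapd r s t u ^ (-(2 * r * t)) * sapb r s t u ^ (r * u + s * t) := by
  have := PresentedGroup.one_of_mem (rels := sapphireRels r s t u)
    (.inr (.inr (.inl rfl)))
  rw [map_mul, map_inv, mul_inv_eq_one] at this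
  simp only [map_mul, map_zpow, map_inv] at this
  exact this

lemma sapa_sq : sapa r s t u ^ 2 = sapd r s t u := by
  have := PresentedGroup.one_of_mem (rels := sapphireRels r s t u)
    (.inr (.inr (.inr (.inl rfl))))
  rw [map_mul, map_inv, mul_inv_eq_one] at this
  simp only [map_pow] at this
  exact this

lemma sapa_conj_sapb : sapa r s t u * sapb r s t u * (sapa r s t u)⁻¹ = (sapb r s t u)⁻¹ := by
  have := PresentedGroup.one_of_mem (rels := sapphireRels r s t u)
    (.inr (.inr (.inr (.inr (.inl rfl)))))
  rw [map_mul, mul_eq_one_iff_eq_inv] at this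
  simp only [map_mul, map_inv] at this
  exact this

lemma sapa_conj_sapv : sapa r s t u * sapv r s t u * (sapa r s t u)⁻¹ =
    sapd r s t u ^ (r - r * u - s * t) * sapb r s t u ^ (s - 2 * s * u) *
      (sapv r s t u)⁻¹ := by
  have := PresentedGroup.one_of_mem (rels := sapphireRels r s t u)
    (.inr (.inr (.inr (.inr (.inr rfl)))))
  rw [map_mul, map_inv, mul_inv_eq_one] at this
  simp only [map_mul, map_zpow, map_inv] at this
  exact this

/-- The element `d ^ i * b ^ j` of the sapphire group. -/
def sapT (r s t u i j : ℤ) : Sapphire r s t u := sapd r s t u ^ i * sapb r s t u ^ j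

lemma sapd_sapb_commute : Commute (sapd r s t u) (sapb r s t u) := sapd_mul_sapb

lemma sapT_mul (i j i' j' : ℤ) :
    sapT r s t u i j * sapT r s t u i' j' = sapT r s t u (i + i') (j + j') := by
  simp only [sapT, _root_.zpow_add]
  rw [mul_assoc, ← mul_assoc (sapb r s t u ^ j),
    ((sapd_sapb_commute (r := r)).zpow_zpow i' j).symm.eq]
  simp only [mul_assoc]

@[simp] lemma sapT_zero : sapT r s t u 0 0 = 1 := by simp [sapT]

lemma sapT_inv (i j : ℤ) : (sapT r s t u i j)⁻¹ = sapT r s t u (-i) (-j) := by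
  rw [inv_eq_iff_mul_eq_one, sapT_mul]; simp

lemma sapT_zpow (i j k : ℤ) : sapT r s t u i j ^ k = sapT r s t u (i * k) (j * k) := by
  rw [sapT, (((sapd_sapb_commute (r := r)).zpow_zpow i j)).mul_zpow, ← _root_.zpow_mul,
    ← _root_.zpow_mul, sapT]

lemma sapd_eq_sapT : sapd r s t u = sapT r s t u 1 0 := by simp [sapT]

lemma sapb_eq_sapT : sapb r s t u = sapT r s t u 0 1 := by simp [sapT]

lemma sapT_mem (i j : ℤ) : sapT r s t u i j ∈ sapDB r s t u :=
  mul_mem (zpow_mem (Subgroup.subset_closure (by simp)) _)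
    (zpow_mem (Subgroup.subset_closure (by simp)) _)

lemma mem_sapDB_iff {g : Sapphire r s t u} :
    g ∈ sapDB r s t u ↔ ∃ i j, g = sapT r s t u i j := by
  refine ⟨fun hg => ?_, by rintro ⟨i, j, rfl⟩; exact sapT_mem i j⟩
  induction hg using Subgroup.closure_induction with
  | mem x hx =>
    rcases hx with rfl | rfl
    exacts [⟨1, 0, sapd_eq_sapT⟩, ⟨0, 1, sapb_eq_sapT⟩]
  | one => exact ⟨0, 0, sapT_zero.symm⟩
  | mul x y _ _ hx hy =>
    obtain ⟨i, j, rfl⟩ := hx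
    obtain ⟨i', j', rfl⟩ := hy
    exact ⟨_, _, sapT_mul _ _ _ _⟩
  | inv x _ hx =>
    obtain ⟨i, j, rfl⟩ := hx
    exact ⟨_, _, sapT_inv _ _⟩

lemma sapv_conj_sapT (i j : ℤ) : sapv r s t u * sapT r s t u i j * (sapv r s t u)⁻¹ =
    sapT r s t u ((r * u + s * t) * i - 2 * r * t * j)
      (-(2 * s * u) * i + (r * u + s * t) * j) := by
  have hd := sapv_conj_sapd (r := r) (s := s) (t := t) (u := u)
  have hb := sapv_conj_sapb (r := r) (s := s) (t := t) (u := u)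
  rw [← sapT] at hd hb
  rw [sapT, ← conj_mul, ← conj_zpow, ← conj_zpow, hd, hb, sapT_zpow, sapT_zpow, sapT_mul]
  congr 1
  ring

lemma sapa_conj_sapT (i j : ℤ) : sapa r s t u * sapT r s t u i j * (sapa r s t u)⁻¹ =
    sapT r s t u i (-j) := by
  have hd : sapa r s t u * sapd r s t u * (sapa r s t u)⁻¹ = sapd r s t u := by
    rw [← sapa_sq]; group
  rw [sapT, ← conj_mul, ← conj_zpow, ← conj_zpow, hd, sapa_conj_sapb, _root_.inv_zpow', sapT]

lemma sapv_inv_conj_sapT (h1 : r * u - s * t = 1) (i j : ℤ) :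
    (sapv r s t u)⁻¹ * sapT r s t u i j * sapv r s t u =
    sapT r s t u ((r * u + s * t) * i + 2 * r * t * j) (2 * s * u * i + (r * u + s * t) * j) := by
  have h := sapv_conj_sapT (r := r) (s := s) (t := t) (u := u)
    ((r * u + s * t) * i + 2 * r * t * j) (2 * s * u * i + (r * u + s * t) * j)
  have hp : (r * u + s * t) * (r * u + s * t) - 4 * (r * s * t * u) = 1 := by
    linear_combination (r * u - s * t + 1) * h1
  have e1 : (r * u + s * t) * ((r * u + s * t) * i + 2 * r * t * j)
      - 2 * r * t * (2 * s * u * i + (r * u + s * t) * j) = i := by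
    linear_combination i * hp
  have e2 : -(2 * s * u) * ((r * u + s * t) * i + 2 * r * t * j)
      + (r * u + s * t) * (2 * s * u * i + (r * u + s * t) * j) = j := by
    linear_combination j * hp
  rw [e1, e2] at h
  rw [← h]; group

lemma sapDB_normal (h1 : r * u - s * t = 1) : (sapDB r s t u).Normal := by
  rw [← Subgroup.normalizer_eq_top_iff, eq_top_iff, ← PresentedGroup.closure_range_of,
    Subgroup.closure_le]
  rintro _ ⟨x, rfl⟩
  have key : ∀ g : Sapphire r s t u,
      (∀ i j, g * sapT r s t u i j * g⁻¹ ∈ sapDB r s t u) →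
      (∀ i j, g⁻¹ * sapT r s t u i j * g ∈ sapDB r s t u) →
      g ∈ Subgroup.normalizer (sapDB r s t u : Set (Sapphire r s t u)) := by
    intro g hg hg'
    refine Subgroup.mem_normalizer_iff.2 fun h => ⟨fun hh => ?_, fun hh => ?_⟩
    · obtain ⟨i, j, rfl⟩ := mem_sapDB_iff.1 hh
      exact hg i j
    · obtain ⟨i, j, hij⟩ := mem_sapDB_iff.1 hh
      have : h = g⁻¹ * sapT r s t u i j * g := by rw [← hij]; group
      rw [this]; exact hg' i j
  have hT : ∀ i j, sapT r s t u i j ∈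
      Subgroup.normalizer (sapDB r s t u : Set (Sapphire r s t u)) :=
    fun i j => Subgroup.le_normalizer (sapT_mem i j)
  fin_cases x
  · have := hT 1 0
    rwa [← sapd_eq_sapT] at this
  · have := hT 0 1
    rwa [← sapb_eq_sapT] at this
  · refine key (sapv r s t u) (fun i j => ?_) (fun i j => ?_)
    · rw [sapv_conj_sapT]; exact sapT_mem _ _
    · rw [sapv_inv_conj_sapT h1]; exact sapT_mem _ _
  · refine key (sapa r s t u) (fun i j => ?_) (fun i j => ?_)
    · rw [sapa_conj_sapT]; exact sapT_mem _ _
    · have h := sapa_conj_sapT (r := r) (s := s) (t := t) (u := u) i (-j)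
      rw [neg_neg] at h
      have : (sapa r s t u)⁻¹ * sapT r s t u i j * sapa r s t u = sapT r s t u i (-j) := by
        rw [← h]; group
      rw [this]; exact sapT_mem _ _

lemma exists_sapQ (r s t u : ℤ) : ∃ q : Sapphire r s t u →* DihedralGroup 0,
    q (sapd r s t u) = 1 ∧ q (sapb r s t u) = 1 ∧ q (sapv r s t u) = DihedralGroup.r 1 ∧
      q (sapa r s t u) = DihedralGroup.sr 0 := by
  apply Sapphire.exists_hom <;> simp [pow_two]

/-- The quotient map from the sapphire group to the infinite dihedral group. -/
noncomputable def sapQ (r s t u : ℤ) : Sapphire r s t u →* DihedralGroup 0 :=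
  (exists_sapQ r s t u).choose

@[simp] lemma sapQ_d : sapQ r s t u (sapd r s t u) = 1 := (exists_sapQ r s t u).choose_spec.1
@[simp] lemma sapQ_b : sapQ r s t u (sapb r s t u) = 1 := (exists_sapQ r s t u).choose_spec.2.1
@[simp] lemma sapQ_v : sapQ r s t u (sapv r s t u) = DihedralGroup.r 1 :=
  (exists_sapQ r s t u).choose_spec.2.2.1
@[simp] lemma sapQ_a : sapQ r s t u (sapa r s t u) = DihedralGroup.sr 0 :=
  (exists_sapQ r s t u).choose_spec.2.2.2
@[simp] lemma sapQ_T (i j : ℤ) : sapQ r s t u (sapT r s t u i j) = 1 := by simp [sapT]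

/-- A group element and an involution inverting it define a homomorphism from the infinite dihedral
group. -/
lemma exists_dihedralGroup_zero_hom {H : Type*} [Group H] (v a : H) (ha : a * a = 1)
    (hav : a * v * a⁻¹ = v⁻¹) : ∃ f : DihedralGroup 0 →* H,
      f (DihedralGroup.r 1) = v ∧ f (DihedralGroup.sr 0) = a := by
  obtain ⟨P, hP0, hP1, hP, hPa⟩ : ∃ P : ZMod 0 → H, P 0 = 1 ∧ P 1 = v ∧
      (∀ i j, P (i + j) = P i * P j) ∧ ∀ i, P i * a = a * P (-i) := by
    refine ⟨zpowersHom H v ∘ Multiplicative.ofAdd, zpow_zero v, zpow_one v,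
      fun i j => _root_.zpow_add v i j, fun i => ?_⟩
    suffices h : ∀ k : ℤ, v ^ k * a = a * v ^ (-k) from h i
    intro k
    have : a * v ^ (-k) * a⁻¹ = v ^ k := by rw [← conj_zpow, hav]; simp
    rw [← this]; group
  let F : DihedralGroup 0 → H := fun g => match g with
    | DihedralGroup.r k => P k
    | DihedralGroup.sr k => a * P k
  refine ⟨MonoidHom.mk' F ?_, hP1, (congrArg (a * ·) hP0).trans (mul_one a)⟩
  rintro (i | i) (j | j)
  · exact hP i j
  · change a * P (j - i) = P i * (a * P j)
    rw [← mul_assoc, hPa, mul_assoc, ← hP, sub_eq_neg_add]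
  · change a * P (i + j) = a * P i * P j
    rw [mul_assoc, ← hP]
  · change P (j - i) = a * P i * (a * P j)
    rw [← mul_assoc, mul_assoc a, hPa, ← mul_assoc, ha, one_mul, ← hP, sub_eq_neg_add]

lemma sapQ_eq_one_iff (h1 : r * u - s * t = 1) {g : Sapphire r s t u} :
    sapQ r s t u g = 1 ↔ g ∈ sapDB r s t u := by
  have := sapDB_normal h1
  refine ⟨fun hg => ?_, fun hg => ?_⟩
  · have hT : ∀ i j,
        ((sapT r s t u i j : Sapphire r s t u) : Sapphire r s t u ⧸ sapDB r s t u) = 1 :=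
      fun i j => (QuotientGroup.eq_one_iff _).2 (sapT_mem i j)
    obtain ⟨f, hfv, hfa⟩ := exists_dihedralGroup_zero_hom
      (QuotientGroup.mk' (sapDB r s t u) (sapv r s t u))
      (QuotientGroup.mk' (sapDB r s t u) (sapa r s t u))
      (by rw [← map_mul, ← pow_two, sapa_sq, sapd_eq_sapT]; exact hT _ _)
      (by
        rw [← map_inv, ← map_mul, ← map_mul, sapa_conj_sapv, ← sapT, map_mul, map_inv]
        exact (congrArg (· * _) (hT _ _)).trans (one_mul _))
    have hcomp : f.comp (sapQ r s t u) = QuotientGroup.mk' (sapDB r s t u) := by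
      apply Sapphire.hom_ext
      · simp only [MonoidHom.comp_apply, sapQ_d, map_one]
        rw [sapd_eq_sapT]; exact (hT _ _).symm
      · simp only [MonoidHom.comp_apply, sapQ_b, map_one]
        rw [sapb_eq_sapT]; exact (hT _ _).symm
      · simp [hfv]
      · simp [hfa]
    have := DFunLike.congr_fun hcomp g
    rw [MonoidHom.comp_apply, hg, map_one] at this
    exact (QuotientGroup.eq_one_iff _).1 this.symm
  · obtain ⟨i, j, rfl⟩ := mem_sapDB_iff.1 hg
    simp

/-- The affine permutation of `ℤ × ℤ` through which the generator `v` acts. -/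
def sapPermV (h1 : r * u - s * t = 1) : Equiv.Perm (ℤ × ℤ) where
  toFun z := ((r * u + s * t) * z.1 - 2 * r * t * z.2 + (1 - u) * r,
    -(2 * s * u) * z.1 + (r * u + s * t) * z.2 - (1 - u) * s)
  invFun z := ((r * u + s * t) * (z.1 - (1 - u) * r) + 2 * r * t * (z.2 + (1 - u) * s),
    2 * s * u * (z.1 - (1 - u) * r) + (r * u + s * t) * (z.2 + (1 - u) * s))
  left_inv z := by
    ext
    · linear_combination z.1 * (r * u - s * t + 1) * h1
    · linear_combination z.2 * (r * u - s * t + 1) * h1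
  right_inv z := by
    ext
    · linear_combination (z.1 - (1 - u) * r) * (r * u - s * t + 1) * h1
    · linear_combination (z.2 + (1 - u) * s) * (r * u - s * t + 1) * h1

/-- The affine permutation of `ℤ × ℤ` through which the generator `a` acts. -/
def sapPermA : Equiv.Perm (ℤ × ℤ) where
  toFun z := (z.1 + 1, -z.2)
  invFun z := (z.1 - 1, -z.2)
  left_inv z := by simp
  right_inv z := by simp

lemma exists_sapRho (h1 : r * u - s * t = 1) :
    ∃ ρ : Sapphire r s t u →* Equiv.Perm (ℤ × ℤ),
      ρ (sapd r s t u) = Equiv.addRight (2, 0) ∧ ρ (sapb r s t u) = Equiv.addRight (0, 2) ∧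
      ρ (sapv r s t u) = sapPermV h1 ∧ ρ (sapa r s t u) = sapPermA := by
  apply Sapphire.exists_hom
  · ext z <;> simp
  · rw [mul_inv_eq_iff_eq_mul]
    ext z <;> simp [sapPermV] <;> ring
  · rw [mul_inv_eq_iff_eq_mul]
    ext z <;> simp [sapPermV] <;> ring
  · ext z <;> simp [pow_two, sapPermA, add_assoc]
  · rw [mul_inv_eq_iff_eq_mul]
    ext z <;> simp [sapPermA]; ring
  · rw [mul_inv_eq_iff_eq_mul]
    ext z <;> simp [sapPermV, sapPermA, Equiv.Perm.inv_def]
    · grind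
    · grind

/-- The action of the sapphire group on `ℤ × ℤ` by affine permutations. -/
noncomputable def sapRho (h1 : r * u - s * t = 1) :
    Sapphire r s t u →* Equiv.Perm (ℤ × ℤ) := (exists_sapRho h1).choose

lemma sapRho_v (h1 : r * u - s * t = 1) (x y : ℤ) : sapRho h1 (sapv r s t u) (x, y) =
    ((r * u + s * t) * x - 2 * r * t * y + (1 - u) * r,
      -(2 * s * u) * x + (r * u + s * t) * y - (1 - u) * s) := by
  rw [sapRho, (exists_sapRho h1).choose_spec.2.2.1]; rfl

lemma sapRho_v_inv (h1 : r * u - s * t = 1) (x y : ℤ) : (sapRho h1 (sapv r s t u))⁻¹ (x, y) =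
    ((r * u + s * t) * (x - (1 - u) * r) + 2 * r * t * (y + (1 - u) * s),
      2 * s * u * (x - (1 - u) * r) + (r * u + s * t) * (y + (1 - u) * s)) := by
  rw [sapRho, (exists_sapRho h1).choose_spec.2.2.1]; rfl

lemma sapRho_a (h1 : r * u - s * t = 1) (x y : ℤ) :
    sapRho h1 (sapa r s t u) (x, y) = (x + 1, -y) := by
  rw [sapRho, (exists_sapRho h1).choose_spec.2.2.2]; rfl

lemma sapRho_T (h1 : r * u - s * t = 1) (i j x y : ℤ) :
    sapRho h1 (sapT r s t u i j) (x, y) = (x + 2 * i, y + 2 * j) := by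
  rw [sapT, map_mul, map_zpow, map_zpow, sapRho, (exists_sapRho h1).choose_spec.1,
    (exists_sapRho h1).choose_spec.2.1]
  simp [mul_comm]

lemma sapRho_T_inv (h1 : r * u - s * t = 1) (i j x y : ℤ) :
    (sapRho h1 (sapT r s t u i j))⁻¹ (x, y) = (x - 2 * i, y - 2 * j) := by
  rw [← map_inv, sapT_inv, sapRho_T, mul_neg, mul_neg, sub_eq_add_neg, sub_eq_add_neg]

lemma sapT_inj (h1 : r * u - s * t = 1) {i j i' j' : ℤ} :
    sapT r s t u i j = sapT r s t u i' j' ↔ i = i' ∧ j = j' := by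
  refine ⟨fun h => ?_, by rintro ⟨rfl, rfl⟩; rfl⟩
  have := congrArg (fun g => sapRho h1 g (0, 0)) h
  simpa [sapRho_T] using this

/-- Equality in the sapphire group is detected by the infinite dihedral quotient together with the
orbit map of the affine action. -/
lemma Sapphire.ext_rho (h1 : r * u - s * t = 1) {g h : Sapphire r s t u}
    (hq : sapQ r s t u g = sapQ r s t u h)
    (hρ : sapRho h1 g (0, 0) = sapRho h1 h (0, 0)) : g = h := by
  have : g * h⁻¹ ∈ sapDB r s t u := by
    rw [← sapQ_eq_one_iff h1, map_mul, map_inv, hq, mul_inv_cancel]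
  obtain ⟨i, j, hij⟩ := mem_sapDB_iff.1 this
  have hg : g = sapT r s t u i j * h := by rw [← hij]; group
  rw [hg, map_mul, Equiv.Perm.mul_apply] at hρ
  generalize sapRho h1 h (0, 0) = z at hρ
  obtain ⟨x, y⟩ := z
  simp only [sapRho_T, Prod.mk.injEq, add_eq_left, mul_eq_zero, OfNat.ofNat_ne_zero, false_or]
    at hρ
  rw [hg, hρ.1, hρ.2, sapT_zero, one_mul]

/-! ### Construction of automorphisms -/

lemma exists_endo (e f : ℤ) (v a : Sapphire r s t u)
    (hvd : v * sapT r s t u e 0 * v⁻¹ =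
      sapT r s t u (e * (r * u + s * t)) (f * -(2 * s * u)))
    (hvb : v * sapT r s t u 0 f * v⁻¹ =
      sapT r s t u (e * -(2 * r * t)) (f * (r * u + s * t)))
    (had : a ^ 2 = sapT r s t u e 0)
    (hab : a * sapT r s t u 0 f * a⁻¹ = sapT r s t u 0 (-f))
    (hav : a * v * a⁻¹ =
      sapT r s t u (e * (r - r * u - s * t)) (f * (s - 2 * s * u)) * v⁻¹) :
    ∃ φ : Sapphire r s t u →* Sapphire r s t u,
      (∀ i j, φ (sapT r s t u i j) = sapT r s t u (e * i) (f * j)) ∧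
      φ (sapv r s t u) = v ∧ φ (sapa r s t u) = a := by
  obtain ⟨φ, hd, hb, hv, ha⟩ := Sapphire.exists_hom (r := r) (s := s) (t := t) (u := u)
    (sapT r s t u e 0) (sapT r s t u 0 f) v a (by simp [sapT_mul])
    (by rw [sapT_zpow, sapT_zpow, sapT_mul]; simpa using hvd)
    (by rw [sapT_zpow, sapT_zpow, sapT_mul]; simpa using hvb) had
    (by simpa [sapT_inv] using hab) (by simpa [sapT_zpow, sapT_mul] using hav)
  refine ⟨φ, fun i j => ?_, hv, ha⟩
  rw [sapT, map_mul, map_zpow, map_zpow, hd, hb, sapT_zpow, sapT_zpow, sapT_mul]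
  simp

/-- The automorphism fixing `d` and `b` with `v ↦ d ^ (t * m) * b ^ n * v` and
`a ↦ b ^ (n + u * m) * a`, as an endomorphism. -/
lemma exists_shift_endo (h1 : r * u - s * t = 1) (m n : ℤ) :
    ∃ φ : Sapphire r s t u →* Sapphire r s t u,
      (∀ i j, φ (sapT r s t u i j) = sapT r s t u i j) ∧
      φ (sapv r s t u) = sapT r s t u (t * m) n * sapv r s t u ∧
      φ (sapa r s t u) = sapT r s t u 0 (n + u * m) * sapa r s t u := by
  have := exists_endo 1 1 (sapT r s t u (t * m) n * sapv r s t u)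
    (sapT r s t u 0 (n + u * m) * sapa r s t u)
  simp only [one_mul] at this
  apply this <;> clear this
  all_goals try rw [mul_inv_eq_iff_eq_mul]
  all_goals
    apply Sapphire.ext_rho h1
    · simp [pow_two]
    · simp only [pow_two, map_mul, map_inv, _root_.mul_inv_rev, Equiv.Perm.mul_apply,
        sapRho_v, sapRho_v_inv, sapRho_a, sapRho_T, sapRho_T_inv, neg_zero]
      ext <;> grind

/-- The involution inverting `d` and `b`, as an endomorphism. -/
lemma exists_neg_endo (h1 : r * u - s * t = 1) :
    ∃ φ : Sapphire r s t u →* Sapphire r s t u,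
      (∀ i j, φ (sapT r s t u i j) = sapT r s t u (-i) (-j)) ∧
      φ (sapv r s t u) = sapT r s t u (1 - r) s * sapv r s t u ∧
      φ (sapa r s t u) = sapT r s t u (-1) 0 * sapa r s t u := by
  have := exists_endo (-1) (-1) (sapT r s t u (1 - r) s * sapv r s t u)
    (sapT r s t u (-1) 0 * sapa r s t u)
  simp only [neg_one_mul] at this
  apply this <;> clear this
  all_goals try rw [mul_inv_eq_iff_eq_mul]
  all_goals
    apply Sapphire.ext_rho h1
    · simp [pow_two]
    · simp only [pow_two, map_mul, map_inv, _root_.mul_inv_rev, Equiv.Perm.mul_apply,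
        sapRho_v, sapRho_v_inv, sapRho_a, sapRho_T, sapRho_T_inv, neg_zero]
      ext <;> grind

/-- The involution inverting `b` and swapping the two directions of `v`, as an endomorphism. -/
lemma exists_flip_endo (h1 : r * u - s * t = 1) :
    ∃ φ : Sapphire r s t u →* Sapphire r s t u,
      (∀ i j, φ (sapT r s t u i j) = sapT r s t u i (-j)) ∧
      φ (sapv r s t u) = sapT r s t u ((1 - u) * r) ((1 - u) * s) * (sapv r s t u)⁻¹ ∧
      φ (sapa r s t u) = sapa r s t u := by
  have := exists_endo 1 (-1) (sapT r s t u ((1 - u) * r) ((1 - u) * s) * (sapv r s t u)⁻¹)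
    (sapa r s t u)
  simp only [neg_one_mul, one_mul] at this
  apply this <;> clear this
  all_goals try rw [mul_inv_eq_iff_eq_mul]
  all_goals
    apply Sapphire.ext_rho h1
    · simp [pow_two]
    · simp only [pow_two, map_mul, map_inv, _root_.mul_inv_rev, inv_inv, Equiv.Perm.mul_apply,
        sapRho_v, sapRho_v_inv, sapRho_a, sapRho_T, sapRho_T_inv, neg_zero]
      ext <;> grind

/-! ### The subgroup `⟨d, b⟩` is characteristic -/

lemma sapphire_det_nonzero_pos (h1 : r * u - s * t = 1) (h0 : r * s * t * u ≠ 0) :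
    0 < r * s * t * u := by
  have hx : r * s * t * u = (s * t) * (s * t + 1) := by linear_combination s * t * h1
  rw [hx] at h0 ⊢
  rcases lt_trichotomy (s * t) 0 with h | h | h
  · have : s * t + 1 ≠ 0 := right_ne_zero_of_mul h0
    have : s * t + 1 < 0 := by omega
    nlinarith
  · exact absurd (left_ne_zero_of_mul h0) (by simp [h])
  · positivity

/-- Conjugation by `v` is hyperbolic on `⟨d, b⟩`. -/
lemma exists_eigenvalue (h1 : r * u - s * t = 1) (h0 : r * s * t * u ≠ 0) :
    ∃ κ l : ℝ, κ ≠ 0 ∧ (∀ k : ℤ, l ^ k = 1 → k = 0) ∧ ∀ k i j : ℤ, ∃ i' j' : ℤ,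
      sapv r s t u ^ k * sapT r s t u i j * (sapv r s t u ^ k)⁻¹ = sapT r s t u i' j' ∧
      κ * i' - 2 * r * t * j' = l ^ k * (κ * i - 2 * r * t * j) := by
  have hpos := sapphire_det_nonzero_pos h1 h0
  have hposR : (0 : ℝ) < 4 * (r * s * t * u) := by exact_mod_cast (by positivity)
  have h1R : (r * u - s * t : ℝ) = 1 := by exact_mod_cast h1
  obtain ⟨κ, hκ⟩ : ∃ κ : ℝ, κ ^ 2 = 4 * (r * s * t * u) := ⟨√(4 * (r * s * t * u)),
    Real.sq_sqrt hposR.le⟩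
  have hκ0 : κ ≠ 0 := by
    rintro rfl
    rw [← hκ] at hposR
    simp at hposR
  have hinv : (r * u + s * t + κ) * (r * u + s * t - κ) = 1 := by
    linear_combination (r * u - s * t + 1 : ℝ) * h1R - hκ
  have hl0 : (r * u + s * t + κ : ℝ) ≠ 0 := left_ne_zero_of_mul_eq_one hinv
  have hlinv : (r * u + s * t + κ : ℝ)⁻¹ = r * u + s * t - κ :=
    inv_eq_of_mul_eq_one_right hinv
  have hst : (s * t : ℝ) ≠ 0 := by
    intro h
    rw [mul_assoc (r : ℝ), h] at hposR
    simp at hposR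
  have hru : (r * u : ℝ) ≠ 0 := by
    intro h
    have : (4 * (r * s * t * u) : ℝ) = 4 * (s * t) * (r * u) := by ring
    rw [this, h] at hposR
    simp at hposR
  refine ⟨κ, r * u + s * t + κ, hκ0, fun k hk => ?_, fun k => ?_⟩
  · have habs : |(r * u + s * t + κ : ℝ)| ^ k = 1 := by rw [← abs_zpow, hk, abs_one]
    refine (zpow_eq_one_iff_right₀ (abs_nonneg _) fun h => ?_).1 habs
    rcases (abs_eq zero_le_one).1 h with h | h
    · rw [h] at hinv
      exact hst (by linarith)
    · rw [h] at hinv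
      exact hru (by linarith)
  · induction k using Int.induction_on with
    | zero => exact fun i j => ⟨i, j, by simp, by simp⟩
    | succ k ih =>
      intro i j
      obtain ⟨i', j', h, h'⟩ := ih ((r * u + s * t) * i - 2 * r * t * j)
        (-(2 * s * u) * i + (r * u + s * t) * j)
      refine ⟨i', j', ?_, ?_⟩
      · rw [← h, ← sapv_conj_sapT, _root_.zpow_add_one]; group
      · rw [h', zpow_add_one₀ hl0]
        push_cast
        linear_combination -(r * u + s * t + κ : ℝ) ^ (k : ℤ) * i * hκ
    | pred k ih =>
      intro i j
      obtain ⟨i', j', h, h'⟩ := ih ((r * u + s * t) * i + 2 * r * t * j)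
        (2 * s * u * i + (r * u + s * t) * j)
      refine ⟨i', j', ?_, ?_⟩
      · rw [← h, ← sapv_inv_conj_sapT h1, _root_.zpow_sub_one]; group
      · rw [h', zpow_sub_one₀ hl0, hlinv]
        push_cast
        linear_combination (r * u + s * t + κ : ℝ) ^ (-(k : ℤ)) * i * hκ

lemma sapQ_v_zpow_inj {k l : ℤ} :
    sapQ r s t u (sapv r s t u ^ k) = sapQ r s t u (sapv r s t u ^ l) ↔ k = l := by
  simp

lemma sapQ_v_zpow_mul_a_ne {k l : ℤ} :
    sapQ r s t u (sapv r s t u ^ k * sapa r s t u) ≠ sapQ r s t u (sapv r s t u ^ l) := by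
  simp

lemma sapQ_v_zpow_mul_a_inj {k l : ℤ} :
    sapQ r s t u (sapv r s t u ^ k * sapa r s t u) =
      sapQ r s t u (sapv r s t u ^ l * sapa r s t u) ↔ k = l := by
  simp

lemma sapQ_cases (g : Sapphire r s t u) :
    (∃ k : ℤ, sapQ r s t u g = sapQ r s t u (sapv r s t u ^ k)) ∨
    ∃ k : ℤ, sapQ r s t u g = sapQ r s t u (sapv r s t u ^ k * sapa r s t u) := by
  rcases hg : sapQ r s t u g with k | k
  · obtain ⟨l, rfl⟩ := ZMod.intCast_surjective k
    exact .inl ⟨l, by simp⟩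
  · obtain ⟨l, rfl⟩ := ZMod.intCast_surjective k
    exact .inr ⟨-l, by simp⟩

lemma exists_eq_sapT_mul (h1 : r * u - s * t = 1) {g h : Sapphire r s t u}
    (hgh : sapQ r s t u g = sapQ r s t u h) : ∃ i j, g = sapT r s t u i j * h := by
  have : g * h⁻¹ ∈ sapDB r s t u := by
    rw [← sapQ_eq_one_iff h1, map_mul, map_inv, hgh, mul_inv_cancel]
  obtain ⟨i, j, hij⟩ := mem_sapDB_iff.1 this
  exact ⟨i, j, by rw [← hij]; group⟩

lemma sapT_mul_conj_sapT {w : Sapphire r s t u} {i j i' j' : ℤ}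
    (h : w * sapT r s t u i j * w⁻¹ = sapT r s t u i' j') (x y : ℤ) :
    sapT r s t u x y * w * sapT r s t u i j * (sapT r s t u x y * w)⁻¹ =
      sapT r s t u i' j' := by
  have : sapT r s t u x y * w * sapT r s t u i j * (sapT r s t u x y * w)⁻¹ =
      sapT r s t u x y * (w * sapT r s t u i j * w⁻¹) * (sapT r s t u x y)⁻¹ := by group
  rw [this, h, sapT_mul, sapT_inv, sapT_mul]
  congr 1 <;> ring

/-- If `g` commutes with a conjugate of itself by an element of `⟨d, b⟩`, then conjugation by `g`
acts unipotently on that element. -/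
lemma unipotent_of_commute {g : Sapphire r s t u} {i j i' j' i'' j'' : ℤ}
    (h : g * sapT r s t u i j * g⁻¹ = sapT r s t u i' j')
    (h' : g * sapT r s t u i' j' * g⁻¹ = sapT r s t u i'' j'')
    (hc : Commute g (sapT r s t u i j * g * (sapT r s t u i j)⁻¹)) :
    sapT r s t u (2 * i') (2 * j') = sapT r s t u (i + i'') (j + j'') := by
  have e1 : g * (sapT r s t u i j * g * (sapT r s t u i j)⁻¹) =
      (g * sapT r s t u i j * g⁻¹) * (g * (g * sapT r s t u i j * g⁻¹) * g⁻¹)⁻¹ * (g * g) := by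
    group
  have e2 : sapT r s t u i j * g * (sapT r s t u i j)⁻¹ * g =
      sapT r s t u i j * (g * sapT r s t u i j * g⁻¹)⁻¹ * (g * g) := by group
  have hc' := hc.eq
  rw [e1, e2, h, h', mul_left_inj, sapT_inv, sapT_inv, sapT_mul, sapT_mul] at hc'
  have := congrArg (· * sapT r s t u (i' + i'') (j' + j'')) hc'
  simp only [sapT_mul] at this
  convert this using 2 <;> ring

lemma mem_sapDB_iff_commute (h1 : r * u - s * t = 1) (h0 : r * s * t * u ≠ 0)
    {g : Sapphire r s t u} :
    g ∈ sapDB r s t u ↔ ∀ h : Sapphire r s t u, Commute g (h * g * h⁻¹) := by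
  constructor
  · intro hg h
    obtain ⟨i, j, rfl⟩ := mem_sapDB_iff.1 hg
    obtain ⟨i', j', hc⟩ := mem_sapDB_iff.1 ((sapDB_normal h1).conj_mem _ hg h)
    rw [hc, Commute, SemiconjBy, sapT_mul, sapT_mul, add_comm i, add_comm j]
  · intro hg
    obtain ⟨κ, l, hκ, hl, hv⟩ := exists_eigenvalue h1 h0
    rcases sapQ_cases g with ⟨k, hk⟩ | ⟨k, hk⟩
    · obtain ⟨x, y, rfl⟩ := exists_eq_sapT_mul h1 hk
      obtain ⟨i, j, hij, hlij⟩ := hv k 1 0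
      obtain ⟨i', j', hij', hlij'⟩ := hv k i j
      have hu := (sapT_inj h1).1 <| unipotent_of_commute (sapT_mul_conj_sapT hij x y)
        (sapT_mul_conj_sapT hij' x y) (hg _)
      have hu1 : (2 * i : ℝ) = 1 + i' := by exact_mod_cast hu.1
      have hu2 : (2 * j : ℝ) = 0 + j' := by exact_mod_cast hu.2
      rw [hlij] at hlij'
      have : κ * (l ^ k - 1) ^ 2 = 0 := by
        push_cast at hlij hlij'
        linear_combination -κ * hu1 + 2 * r * t * hu2 + 2 * hlij - hlij'
      have hk0 := hl k (sub_eq_zero.1 (pow_eq_zero_iff two_ne_zero |>.1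
        ((mul_eq_zero.1 this).resolve_left hκ)))
      rw [hk0, zpow_zero, mul_one]
      exact sapT_mem x y
    · exfalso
      obtain ⟨x, y, rfl⟩ := exists_eq_sapT_mul h1 hk
      have hconj : ∀ i j i' j', sapv r s t u ^ k * sapT r s t u i (-j) * (sapv r s t u ^ k)⁻¹ =
          sapT r s t u i' j' → (sapv r s t u ^ k * sapa r s t u) * sapT r s t u i j *
            (sapv r s t u ^ k * sapa r s t u)⁻¹ = sapT r s t u i' j' := by
        intro i j i' j' h
        rw [← h, ← sapa_conj_sapT]; group
      have hsq : ∀ i j, (sapT r s t u x y * (sapv r s t u ^ k * sapa r s t u)) *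
          ((sapT r s t u x y * (sapv r s t u ^ k * sapa r s t u)) * sapT r s t u i j *
          (sapT r s t u x y * (sapv r s t u ^ k * sapa r s t u))⁻¹) *
          (sapT r s t u x y * (sapv r s t u ^ k * sapa r s t u))⁻¹ = sapT r s t u i j := by
        intro i j
        generalize hg' : sapT r s t u x y * (sapv r s t u ^ k * sapa r s t u) = g'
        have hm : g' * g' ∈ sapDB r s t u := by
          rw [← sapQ_eq_one_iff h1, ← hg']; simp
        obtain ⟨x', y', hm⟩ := mem_sapDB_iff.1 hm
        have : g' * (g' * sapT r s t u i j * g'⁻¹) * g'⁻¹ =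
            (g' * g') * sapT r s t u i j * (g' * g')⁻¹ := by group
        rw [this, hm, sapT_mul, sapT_inv, sapT_mul]
        congr 1 <;> ring
      have hfix : ∀ i j, sapv r s t u ^ k * sapT r s t u i (-j) * (sapv r s t u ^ k)⁻¹ =
          sapT r s t u i j := by
        intro i j
        obtain ⟨i', j', hij, -⟩ := hv k i (-j)
        have e1 := sapT_mul_conj_sapT (hconj i j i' j' hij) x y
        have e2 := hsq i j
        rw [e1] at e2
        have hu := (sapT_inj h1).1 <| unipotent_of_commute e1 e2 (hg _)
        rw [hij, sapT_inj h1]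
        omega
      obtain ⟨i, j, hij, hlij⟩ := hv k 1 0
      have hd := hfix 1 0
      rw [neg_zero, hij, sapT_inj h1] at hd
      rw [hd.1, hd.2] at hlij
      have hk0 : k = 0 := hl k (mul_right_cancel₀ hκ (by push_cast at hlij; linarith))
      have hb := hfix 0 1
      rw [hk0, zpow_zero, inv_one, one_mul, mul_one, sapT_inj h1] at hb
      omega

lemma Sapphire.hom_ext_sapT {H : Type*} [Group H] {f g : Sapphire r s t u →* H}
    (hT : ∀ i j, f (sapT r s t u i j) = g (sapT r s t u i j))
    (hv : f (sapv r s t u) = g (sapv r s t u)) (ha : f (sapa r s t u) = g (sapa r s t u)) :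
    f = g :=
  Sapphire.hom_ext (by rw [sapd_eq_sapT, hT]) (by rw [sapb_eq_sapT, hT]) hv ha

lemma Sapphire.mulAut_ext {φ φ' : MulAut (Sapphire r s t u)}
    (hT : ∀ i j, φ (sapT r s t u i j) = φ' (sapT r s t u i j))
    (hv : φ (sapv r s t u) = φ' (sapv r s t u)) (ha : φ (sapa r s t u) = φ' (sapa r s t u)) :
    φ = φ' :=
  MulEquiv.toMonoidHom_injective (Sapphire.hom_ext_sapT hT hv ha)

/-- An endomorphism squaring to the identity is an automorphism. -/
lemma exists_mulAut_of_comp_self {G : Type*} [Group G] (f : G →* G)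
    (hf : f.comp f = MonoidHom.id G) : ∃ φ : MulAut G, φ * φ = 1 ∧ ∀ g, φ g = f g :=
  ⟨MonoidHom.toMulEquiv f f hf hf, MulEquiv.ext fun g => DFunLike.congr_fun hf g, fun _ => rfl⟩

lemma exists_shift_aut (h1 : r * u - s * t = 1) :
    ∃ Φ : Multiplicative (ℤ × ℤ) →* MulAut (Sapphire r s t u), ∀ x,
      (∀ i j, Φ x (sapT r s t u i j) = sapT r s t u i j) ∧
      Φ x (sapv r s t u) = sapT r s t u (t * x.toAdd.1) x.toAdd.2 * sapv r s t u ∧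
      Φ x (sapa r s t u) = sapT r s t u 0 (x.toAdd.2 + u * x.toAdd.1) * sapa r s t u := by
  choose f hT hv ha using exists_shift_endo h1
  have hmul : ∀ m n m' n', (f m n).comp (f m' n') = f (m + m') (n + n') := by
    intro m n m' n'
    apply Sapphire.hom_ext_sapT
    · simp [hT]
    · simp only [MonoidHom.comp_apply, hv, map_mul, hT, ← mul_assoc, sapT_mul]
      congr 2 <;> ring
    · simp only [MonoidHom.comp_apply, ha, map_mul, hT, ← mul_assoc, sapT_mul]
      congr 2; ring
  have hone : f 0 0 = MonoidHom.id _ := by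
    apply Sapphire.hom_ext_sapT <;> simp [hT, hv, ha]
  refine ⟨MonoidHom.mk' (fun x => MonoidHom.toMulEquiv (f x.toAdd.1 x.toAdd.2)
    (f (-x.toAdd.1) (-x.toAdd.2)) (by rw [hmul]; simp [hone]) (by rw [hmul]; simp [hone]))
    fun x y => MulEquiv.ext fun g => ?_, fun x => ⟨hT _ _, hv _ _, ha _ _⟩⟩
  exact (DFunLike.congr_fun (hmul _ _ _ _) g).symm

lemma exists_neg_aut (h1 : r * u - s * t = 1) :
    ∃ τ : MulAut (Sapphire r s t u), τ * τ = 1 ∧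
      (∀ i j, τ (sapT r s t u i j) = sapT r s t u (-i) (-j)) ∧
      τ (sapv r s t u) = sapT r s t u (1 - r) s * sapv r s t u ∧
      τ (sapa r s t u) = sapT r s t u (-1) 0 * sapa r s t u := by
  obtain ⟨f, hT, hv, ha⟩ := exists_neg_endo h1
  obtain ⟨τ, hτ, h⟩ := exists_mulAut_of_comp_self f <| by
    apply Sapphire.hom_ext_sapT <;> simp [hT, hv, ha, ← mul_assoc, sapT_mul]
  exact ⟨τ, hτ, by simp [h, hT], by rw [h, hv], by rw [h, ha]⟩

lemma exists_flip_aut (h1 : r * u - s * t = 1) :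
    ∃ ζ : MulAut (Sapphire r s t u), ζ * ζ = 1 ∧
      ζ (sapv r s t u) = sapT r s t u ((1 - u) * r) ((1 - u) * s) * (sapv r s t u)⁻¹ := by
  obtain ⟨f, hT, hv, ha⟩ := exists_flip_endo h1
  obtain ⟨ζ, hζ, h⟩ := exists_mulAut_of_comp_self f <| by
    apply Sapphire.hom_ext_sapT
    · simp [hT]
    · simp only [MonoidHom.comp_apply, hv, map_mul, map_inv, hT, MonoidHom.id_apply]
      apply Sapphire.ext_rho h1
      · simp
      · simp only [map_mul, map_inv, _root_.mul_inv_rev, inv_inv, Equiv.Perm.mul_apply,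
          sapRho_v, sapRho_T, sapRho_T_inv]
        ext <;> grind
    · simp [ha]
  exact ⟨ζ, hζ, by rw [h, hv]⟩

/-! ### The action of automorphisms on the infinite dihedral quotient -/

lemma mulAut_mem_sapDB_iff (h1 : r * u - s * t = 1) (h0 : r * s * t * u ≠ 0)
    (φ : MulAut (Sapphire r s t u)) {g : Sapphire r s t u} :
    φ g ∈ sapDB r s t u ↔ g ∈ sapDB r s t u := by
  rw [mem_sapDB_iff_commute h1 h0, mem_sapDB_iff_commute h1 h0]
  refine ⟨fun h x => φ.injective ?_, fun h x => ?_⟩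
  · simpa using (h (φ x)).eq
  · obtain ⟨y, rfl⟩ := φ.surjective x
    simpa using (h y).map φ

lemma sapQ_mulAut_congr (h1 : r * u - s * t = 1) (h0 : r * s * t * u ≠ 0)
    (φ : MulAut (Sapphire r s t u)) {g h : Sapphire r s t u} :
    sapQ r s t u (φ g) = sapQ r s t u (φ h) ↔ sapQ r s t u g = sapQ r s t u h := by
  rw [← mul_inv_eq_one, ← map_inv, ← map_mul, ← map_inv φ, ← map_mul φ, sapQ_eq_one_iff h1,
    mulAut_mem_sapDB_iff h1 h0, ← sapQ_eq_one_iff h1, map_mul, map_inv, mul_inv_eq_one]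

lemma sapQ_mulAut_inv (h1 : r * u - s * t = 1) (h0 : r * s * t * u ≠ 0)
    {φ : MulAut (Sapphire r s t u)} {g : Sapphire r s t u} :
    sapQ r s t u (φ⁻¹ g) = sapQ r s t u g ↔ sapQ r s t u (φ g) = sapQ r s t u g := by
  rw [← sapQ_mulAut_congr h1 h0 φ, MulAut.apply_inv_self, eq_comm]

lemma exists_sapQ_mulAut_v (h1 : r * u - s * t = 1) (h0 : r * s * t * u ≠ 0)
    (φ : MulAut (Sapphire r s t u)) :
    ∃ k : ℤ, sapQ r s t u (φ (sapv r s t u)) = sapQ r s t u (sapv r s t u ^ k) := by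
  refine (sapQ_cases (φ (sapv r s t u))).resolve_right ?_
  rintro ⟨k, hk⟩
  have h : sapQ r s t u (φ (sapv r s t u ^ (2 : ℤ))) =
      sapQ r s t u (φ (sapv r s t u ^ (0 : ℤ))) := by
    rw [zpow_zero, map_one, map_one, zpow_two, map_mul, map_mul, hk]
    simp
  rw [sapQ_mulAut_congr h1 h0, sapQ_v_zpow_inj] at h
  omega

lemma sapQ_mulAut_v (h1 : r * u - s * t = 1) (h0 : r * s * t * u ≠ 0)
    (φ : MulAut (Sapphire r s t u)) :
    sapQ r s t u (φ (sapv r s t u)) = sapQ r s t u (sapv r s t u) ∨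
      sapQ r s t u (φ (sapv r s t u)) = sapQ r s t u (sapv r s t u)⁻¹ := by
  obtain ⟨k, hk⟩ := exists_sapQ_mulAut_v h1 h0 φ
  obtain ⟨l, hl⟩ := exists_sapQ_mulAut_v h1 h0 φ⁻¹
  rw [← sapQ_mulAut_congr h1 h0 φ, MulAut.apply_inv_self, map_zpow, map_zpow, hk, ← map_zpow,
    ← _root_.zpow_mul] at hl
  nth_rewrite 1 [← zpow_one (sapv r s t u)] at hl
  rw [sapQ_v_zpow_inj] at hl
  rcases Int.eq_one_or_neg_one_of_mul_eq_one hl.symm with rfl | rfl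
  · exact .inl (by rw [hk, zpow_one])
  · exact .inr (by rw [hk, _root_.zpow_neg_one])

lemma exists_sapQ_mulAut_a (h1 : r * u - s * t = 1) (h0 : r * s * t * u ≠ 0)
    (φ : MulAut (Sapphire r s t u)) :
    ∃ k : ℤ, sapQ r s t u (φ (sapa r s t u)) =
      sapQ r s t u (sapv r s t u ^ k * sapa r s t u) := by
  refine (sapQ_cases (φ (sapa r s t u))).resolve_left ?_
  rintro ⟨k, hk⟩
  have h : sapQ r s t u (φ (sapa r s t u ^ 2)) = sapQ r s t u (φ 1) := by
    rw [sapQ_mulAut_congr h1 h0, sapa_sq, sapQ_d, map_one]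
  rw [map_pow, map_pow, hk, ← map_pow, ← zpow_natCast, ← _root_.zpow_mul, map_one,
    ← zpow_zero (sapv r s t u), sapQ_v_zpow_inj] at h
  obtain rfl : k = 0 := by simpa using h
  rw [zpow_zero, ← map_one φ, sapQ_mulAut_congr h1 h0] at hk
  exact sapQ_v_zpow_mul_a_ne (k := 0) (l := 0) (by rwa [zpow_zero, one_mul])

lemma mem_sapAut₀_iff (h1 : r * u - s * t = 1) (h0 : r * s * t * u ≠ 0)
    {φ : MulAut (Sapphire r s t u)} :
    φ ∈ sapAut₀ r s t u ↔ sapQ r s t u (φ (sapv r s t u)) = sapQ r s t u (sapv r s t u) := by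
  constructor
  · rintro ⟨-, g, hg, h⟩
    rw [h, map_mul, (sapQ_eq_one_iff h1).2 hg, one_mul]
  · intro h
    refine ⟨?_, ?_⟩
    · ext g
      refine ⟨?_, fun hg => ⟨φ⁻¹ g, (mulAut_mem_sapDB_iff h1 h0 _).2 hg, ?_⟩⟩
      · rintro ⟨x, hx, rfl⟩
        exact (mulAut_mem_sapDB_iff h1 h0 φ).2 hx
      · exact MulAut.apply_inv_self _ φ g
    · obtain ⟨i, j, hij⟩ := exists_eq_sapT_mul h1 h
      exact ⟨_, sapT_mem i j, hij⟩

/-- Two automorphisms outside `Aut₀(E)` differ by an element of `Aut₀(E)`. -/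
lemma mul_mem_sapAut₀ (h1 : r * u - s * t = 1) (h0 : r * s * t * u ≠ 0)
    {φ φ' : MulAut (Sapphire r s t u)} (h : φ ∉ sapAut₀ r s t u) (h' : φ' ∉ sapAut₀ r s t u) :
    φ * φ' ∈ sapAut₀ r s t u := by
  rw [mem_sapAut₀_iff h1 h0] at h h' ⊢
  replace h := (sapQ_mulAut_v h1 h0 φ).resolve_left h
  replace h' := (sapQ_mulAut_v h1 h0 φ').resolve_left h'
  rw [MulAut.mul_apply, (sapQ_mulAut_congr h1 h0 φ).2 h', map_inv, map_inv, h, map_inv, inv_inv]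

lemma flip_notMem_sapAut₀ (h1 : r * u - s * t = 1) (h0 : r * s * t * u ≠ 0)
    {ζ : MulAut (Sapphire r s t u)} {i j : ℤ}
    (hζ : ζ (sapv r s t u) = sapT r s t u i j * (sapv r s t u)⁻¹) : ζ ∉ sapAut₀ r s t u := by
  rw [mem_sapAut₀_iff h1 h0, hζ, map_mul, sapQ_T, one_mul, ← _root_.zpow_neg_one,
    ← zpow_one (sapv r s t u),
    ← _root_.zpow_mul, sapQ_v_zpow_inj]
  omega

/-! ### Automorphisms acting trivially on the dihedral quotient -/

lemma exists_mulAut_sapT (h1 : r * u - s * t = 1) (h0 : r * s * t * u ≠ 0)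
    {φ : MulAut (Sapphire r s t u)}
    (hv : sapQ r s t u (φ (sapv r s t u)) = sapQ r s t u (sapv r s t u))
    (ha : sapQ r s t u (φ (sapa r s t u)) = sapQ r s t u (sapa r s t u)) :
    ∃ e : ℤ, ∀ i j, φ (sapT r s t u i j) = sapT r s t u (e * i) (e * j) := by
  obtain ⟨e, g, hd⟩ := mem_sapDB_iff.1 ((mulAut_mem_sapDB_iff h1 h0 φ).2 (sapT_mem 1 0))
  obtain ⟨g', f, hb⟩ := mem_sapDB_iff.1 ((mulAut_mem_sapDB_iff h1 h0 φ).2 (sapT_mem 0 1))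
  have hT : ∀ i j, φ (sapT r s t u i j) = sapT r s t u (e * i + g' * j) (g * i + f * j) := by
    intro i j
    rw [sapT, map_mul, map_zpow, map_zpow, sapd_eq_sapT, sapb_eq_sapT, hd, hb, sapT_zpow,
      sapT_zpow, sapT_mul]
  obtain ⟨x, y, hx⟩ := exists_eq_sapT_mul h1 hv
  obtain ⟨x', y', hy⟩ := exists_eq_sapT_mul h1 ha
  have hva : ∀ i j, sapT r s t u (e * i + g' * -j) (g * i + f * -j) =
      sapT r s t u (e * i + g' * j) (-(g * i + f * j)) := by
    intro i j
    have := congrArg φ (sapa_conj_sapT (r := r) (s := s) (t := t) (u := u) i j)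
    rw [map_mul, map_mul, map_inv, hT, hT, hy, sapT_mul_conj_sapT (sapa_conj_sapT _ _)] at this
    exact this.symm
  have hvv : ∀ i j, sapT r s t u (e * ((r * u + s * t) * i - 2 * r * t * j) +
      g' * (-(2 * s * u) * i + (r * u + s * t) * j)) (g * ((r * u + s * t) * i - 2 * r * t * j) +
      f * (-(2 * s * u) * i + (r * u + s * t) * j)) =
      sapT r s t u ((r * u + s * t) * (e * i + g' * j) - 2 * r * t * (g * i + f * j))
        (-(2 * s * u) * (e * i + g' * j) + (r * u + s * t) * (g * i + f * j)) := by
    intro i j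
    have := congrArg φ (sapv_conj_sapT (r := r) (s := s) (t := t) (u := u) i j)
    rw [map_mul, map_mul, map_inv, hT, hT, hx, sapT_mul_conj_sapT (sapv_conj_sapT _ _)] at this
    exact this.symm
  obtain rfl : g = 0 := by
    have := ((sapT_inj h1).1 (hva 1 0)).2
    omega
  obtain rfl : g' = 0 := by
    have := ((sapT_inj h1).1 (hva 0 1)).1
    omega
  obtain rfl : e = f := by
    have h := ((sapT_inj h1).1 (hvv 1 0)).2
    have hsu : s * u ≠ 0 := by
      rintro h'
      exact h0 (by linear_combination r * t * h')
    refine mul_left_cancel₀ hsu ?_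
    linarith
  exact ⟨e, fun i j => by rw [hT]; simp⟩

/-- An automorphism acting trivially on the dihedral quotient acts on `⟨d, b⟩` by `1` or `-1`. -/
lemma mulAut_sapT (h1 : r * u - s * t = 1) (h0 : r * s * t * u ≠ 0)
    {φ : MulAut (Sapphire r s t u)}
    (hv : sapQ r s t u (φ (sapv r s t u)) = sapQ r s t u (sapv r s t u))
    (ha : sapQ r s t u (φ (sapa r s t u)) = sapQ r s t u (sapa r s t u)) :
    (∀ i j, φ (sapT r s t u i j) = sapT r s t u i j) ∨
      ∀ i j, φ (sapT r s t u i j) = sapT r s t u (-i) (-j) := by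
  obtain ⟨e, he⟩ := exists_mulAut_sapT h1 h0 hv ha
  obtain ⟨e', he'⟩ := exists_mulAut_sapT h1 h0 ((sapQ_mulAut_inv h1 h0).2 hv)
    ((sapQ_mulAut_inv h1 h0).2 ha)
  have h : φ (φ⁻¹ (sapT r s t u 1 0)) = sapT r s t u 1 0 := MulAut.apply_inv_self _ _ _
  rw [he', he, sapT_inj h1, mul_one] at h
  rcases Int.eq_one_or_neg_one_of_mul_eq_one h.1 with rfl | rfl
  · exact .inl (by simpa using he)
  · exact .inr (by simpa using he)

/-- The automorphisms acting trivially both on the dihedral quotient and on `⟨d, b⟩`. -/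
lemma exists_shift_parameters (h1 : r * u - s * t = 1) (h0 : r * s * t * u ≠ 0)
    {φ : MulAut (Sapphire r s t u)}
    (hv : sapQ r s t u (φ (sapv r s t u)) = sapQ r s t u (sapv r s t u))
    (ha : sapQ r s t u (φ (sapa r s t u)) = sapQ r s t u (sapa r s t u))
    (hT : ∀ i j, φ (sapT r s t u i j) = sapT r s t u i j) :
    ∃ m n : ℤ, φ (sapv r s t u) = sapT r s t u (t * m) n * sapv r s t u ∧
      φ (sapa r s t u) = sapT r s t u 0 (n + u * m) * sapa r s t u := by
  obtain ⟨x, y, hx⟩ := exists_eq_sapT_mul h1 hv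
  obtain ⟨x', y', hy⟩ := exists_eq_sapT_mul h1 ha
  have hr : r ≠ 0 := by rintro rfl; simp at h0
  obtain rfl : x' = 0 := by
    have h := congrArg φ (sapa_sq (r := r) (s := s) (t := t) (u := u))
    rw [map_pow, sapd_eq_sapT, hT, hy] at h
    have := congrArg (fun g => (sapRho h1 g (0, 0)).1) h
    simp only [pow_two, map_mul, Equiv.Perm.mul_apply, sapRho_a, sapRho_T] at this
    omega
  have hxy : u * x = t * (y' - y) := by
    have h := sapa_conj_sapv (r := r) (s := s) (t := t) (u := u)
    rw [← sapT, mul_inv_eq_iff_eq_mul] at h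
    replace h := congrArg φ h
    rw [map_mul, map_mul, map_mul, map_inv, hT, hx, hy] at h
    have := congrArg (fun g => (sapRho h1 g (0, 0)).1) h
    simp only [map_mul, map_inv, _root_.mul_inv_rev, Equiv.Perm.mul_apply, sapRho_v, sapRho_v_inv,
      sapRho_a, sapRho_T, sapRho_T_inv, neg_zero] at this
    refine mul_left_cancel₀ hr ?_
    grind
  refine ⟨r * (y' - y) - s * x, y, ?_, ?_⟩
  · rw [hx, show t * (r * (y' - y) - s * x) = x by linear_combination x * h1 - r * hxy]
  · rw [hy, show y + u * (r * (y' - y) - s * x) = y' by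
      linear_combination (y' - y) * h1 - s * hxy]

/-- The automorphisms acting trivially on the dihedral quotient form a semidirect product of
`ℤ × ℤ` and a group of order two. -/
lemma exists_kernel_hom (h1 : r * u - s * t = 1) (h0 : r * s * t * u ≠ 0) :
    ∃ ψ : Multiplicative (ZMod 2) →* MulAut (Multiplicative (ℤ × ℤ)),
      (∀ x, ψ (ofAdd 1) x = x⁻¹) ∧
      ∃ j : Multiplicative (ℤ × ℤ) ⋊[ψ] Multiplicative (ZMod 2) →* MulAut (Sapphire r s t u),
        Function.Injective j ∧ ∀ φ, φ ∈ j.range ↔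
          sapQ r s t u (φ (sapv r s t u)) = sapQ r s t u (sapv r s t u) ∧
          sapQ r s t u (φ (sapa r s t u)) = sapQ r s t u (sapa r s t u) := by
  obtain ⟨Φ, hΦ⟩ := exists_shift_aut h1
  obtain ⟨τ, hτ, hτT, hτv, hτa⟩ := exists_neg_aut h1
  have ht : t ≠ 0 := by rintro rfl; simp at h0
  have hΦi : Function.Injective Φ := by
    intro x y hxy
    have := DFunLike.congr_fun hxy (sapv r s t u)
    rw [(hΦ x).2.1, (hΦ y).2.1, mul_left_inj, sapT_inj h1] at this
    exact Prod.ext (mul_left_cancel₀ ht this.1) this.2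
  have hinv : ∀ x, Φ x⁻¹ = τ * Φ x * τ⁻¹ := by
    intro x
    rw [inv_eq_of_mul_eq_one_right hτ]
    apply Sapphire.mulAut_ext
    · simp only [MulAut.mul_apply, hτT, (hΦ _).1, neg_neg, implies_true]
    · simp only [MulAut.mul_apply, hτv, (hΦ _).2.1, map_mul, hτT, (hΦ _).1, ← mul_assoc, sapT_mul]
      congr 2 <;> simp; ring
    · simp only [MulAut.mul_apply, hτa, (hΦ _).2.2, map_mul, hτT, (hΦ _).1, ← mul_assoc, sapT_mul]
      congr 2; simp; ring
  have hτΦ : τ ∉ Φ.range := by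
    rintro ⟨x, rfl⟩
    have := hτT 1 0
    rw [(hΦ x).1, sapT_inj h1] at this
    omega
  obtain ⟨ψ, hψ, j, hj, hjr⟩ := exists_semidirectProduct_zmod_two hΦi hτ hτΦ
    fun x => ⟨x⁻¹, hinv x⟩
  have hΦr : ∀ φ ∈ Φ.range, sapQ r s t u (φ (sapv r s t u)) = sapQ r s t u (sapv r s t u) ∧
      sapQ r s t u (φ (sapa r s t u)) = sapQ r s t u (sapa r s t u) := by
    rintro _ ⟨x, rfl⟩
    simp [(hΦ x).2.1, (hΦ x).2.2]
  have hQτ : ∀ φ : MulAut (Sapphire r s t u),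
      sapQ r s t u ((φ * τ) (sapv r s t u)) = sapQ r s t u (φ (sapv r s t u)) ∧
      sapQ r s t u ((φ * τ) (sapa r s t u)) = sapQ r s t u (φ (sapa r s t u)) := by
    intro φ
    rw [MulAut.mul_apply, MulAut.mul_apply, sapQ_mulAut_congr h1 h0, sapQ_mulAut_congr h1 h0]
    simp [hτv, hτa]
  have hmem : ∀ φ : MulAut (Sapphire r s t u),
      sapQ r s t u (φ (sapv r s t u)) = sapQ r s t u (sapv r s t u) →
      sapQ r s t u (φ (sapa r s t u)) = sapQ r s t u (sapa r s t u) →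
      (∀ i j, φ (sapT r s t u i j) = sapT r s t u i j) → φ ∈ Φ.range := by
    intro φ hv ha hT
    obtain ⟨m, n, hv, ha⟩ := exists_shift_parameters h1 h0 hv ha hT
    exact ⟨ofAdd (m, n), Sapphire.mulAut_ext (fun i j => by rw [(hΦ _).1, hT])
      (by rw [(hΦ _).2.1, hv]; rfl) (by rw [(hΦ _).2.2, ha]; rfl)⟩
  refine ⟨ψ, fun x => hΦi (by rw [hψ, hinv]), j, hj, fun φ => ?_⟩
  rw [hjr]
  refine ⟨?_, fun ⟨hv, ha⟩ => ?_⟩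
  · rintro (h | h)
    · exact hΦr φ h
    · rw [← (hQτ φ).1, ← (hQτ φ).2]
      exact hΦr _ h
  · refine (mulAut_sapT h1 h0 hv ha).imp (hmem φ hv ha) fun hT => ?_
    refine hmem _ ((hQτ φ).1.trans hv) ((hQτ φ).2.trans ha) fun i j => ?_
    rw [MulAut.mul_apply, hτT, hT, neg_neg, neg_neg]

/-! ### The structure of the automorphism group -/

/-- The homomorphism from `Aut₀(E)` to `ℤ` recording the action on the dihedral quotient. -/
lemma exists_sapAut₀_hom (h1 : r * u - s * t = 1) (h0 : r * s * t * u ≠ 0) :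
    ∃ κ : sapAut₀ r s t u →* Multiplicative ℤ, ∀ φ : sapAut₀ r s t u,
      sapQ r s t u (φ.1 (sapa r s t u)) =
        sapQ r s t u (sapv r s t u ^ (κ φ).toAdd * sapa r s t u) := by
  choose k hk using exists_sapQ_mulAut_a h1 h0 (r := r) (s := s) (t := t) (u := u)
  refine ⟨MonoidHom.mk' (fun φ => ofAdd (k φ.1)) fun φ φ' => ?_, fun φ => hk φ.1⟩
  refine congrArg ofAdd ((sapQ_v_zpow_mul_a_inj (r := r) (s := s) (t := t) (u := u)).1 ?_ :
    k (φ * φ') = k φ + k φ')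
  rw [← hk, MulAut.mul_apply, (sapQ_mulAut_congr h1 h0 φ.1).2 (hk φ'.1), map_mul, map_mul,
    hk φ.1, map_zpow, map_zpow, (mem_sapAut₀_iff h1 h0).1 φ.2, ← map_zpow, ← map_mul,
    ← mul_assoc, ← _root_.zpow_add, add_comm]

lemma exists_sapAut₀_equiv (h1 : r * u - s * t = 1) (h0 : r * s * t * u ≠ 0) :
    ∃ ψ₂ : Multiplicative (ZMod 2) →* MulAut (Multiplicative (ℤ × ℤ)),
      (∀ x, ψ₂ (ofAdd 1) x = x⁻¹) ∧
      ∃ ψ₁ : Multiplicative ℤ →* MulAut (Multiplicative (ℤ × ℤ) ⋊[ψ₂] Multiplicative (ZMod 2)),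
        ∃ j : (Multiplicative (ℤ × ℤ) ⋊[ψ₂] Multiplicative (ZMod 2)) ⋊[ψ₁] Multiplicative ℤ →*
          MulAut (Sapphire r s t u), Function.Injective j ∧ j.range = sapAut₀ r s t u := by
  obtain ⟨ψ₂, hψ₂, j, hj, hjr⟩ := exists_kernel_hom h1 h0
  obtain ⟨κ, hκ⟩ := exists_sapAut₀_hom h1 h0
  have hker : ∀ φ : sapAut₀ r s t u, φ.1 ∈ j.range ↔ κ φ = 1 := by
    intro φ
    rw [hjr, hκ φ, ← one_mul (sapa r s t u), ← zpow_zero (sapv r s t u), ← mul_assoc,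
      ← _root_.zpow_add, sapQ_v_zpow_mul_a_inj, add_zero]
    exact and_iff_right ((mem_sapAut₀_iff h1 h0).1 φ.2)
  have hjle : ∀ φ ∈ j.range, φ ∈ sapAut₀ r s t u := fun φ hφ =>
    (mem_sapAut₀_iff h1 h0).2 ((hjr φ).1 hφ).1
  obtain ⟨φ₀, hφ₀⟩ : ∃ φ₀ : sapAut₀ r s t u, ∀ φ, ∃ k : ℤ, κ φ₀ ^ k = κ φ := by
    obtain ⟨⟨_, φ₀, rfl⟩, h⟩ := IsCyclic.exists_generator (α := κ.range)
    refine ⟨φ₀, fun φ => ?_⟩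
    obtain ⟨k, hk⟩ := h ⟨κ φ, φ, rfl⟩
    exact ⟨k, congrArg Subtype.val hk⟩
  have hne : κ φ₀ ≠ 1 := by
    intro h
    have hc : MulAut.conj (sapv r s t u) ∈ sapAut₀ r s t u := by
      rw [mem_sapAut₀_iff h1 h0]; simp
    obtain ⟨k, hk⟩ := hφ₀ ⟨_, hc⟩
    have := hκ ⟨_, hc⟩
    rw [← hk, h, _root_.one_zpow] at this
    have h2 : sapQ r s t u (MulAut.conj (sapv r s t u) (sapa r s t u)) =
        sapQ r s t u (sapv r s t u ^ (2 : ℤ) * sapa r s t u) := by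
      simp
      rfl
    rw [h2, sapQ_v_zpow_mul_a_inj] at this
    simp at this
  have hzpow : ∀ k : ℤ, κ φ₀ ^ k = 1 → k = 0 := by
    intro k hk
    have : k * (κ φ₀).toAdd = 0 := by simpa using congrArg toAdd hk
    exact (mul_eq_zero.1 this).resolve_right hne
  obtain ⟨ψ₁, j₁, hj₁, hj₁r⟩ := exists_semidirectProduct_int hj φ₀.1
    (fun k hk => hzpow k (by rw [← map_zpow]; exact (hker (φ₀ ^ k)).1 hk))
    fun k x => by
      have hx : j x ∈ j.range := ⟨x, rfl⟩
      refine (hker (φ₀ ^ k * ⟨j x, hjle _ hx⟩ * (φ₀ ^ k)⁻¹)).2 ?_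
      rw [map_mul, map_mul, map_inv, (hker ⟨j x, hjle _ hx⟩).1 hx, mul_one, mul_inv_cancel]
  refine ⟨ψ₂, hψ₂, ψ₁, j₁, hj₁, ?_⟩
  ext φ
  rw [hj₁r]
  refine ⟨?_, fun hφ => ?_⟩
  · rintro ⟨k, hk⟩
    exact (Subgroup.mul_mem_cancel_right _ (zpow_mem φ₀.2 k)).1 (hjle _ hk)
  · obtain ⟨k, hk⟩ := hφ₀ ⟨φ, hφ⟩
    refine ⟨-k, (hker (⟨φ, hφ⟩ * φ₀ ^ (-k))).2 ?_⟩
    rw [map_mul, map_zpow, ← hk, ← _root_.zpow_add, add_neg_cancel, zpow_zero]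

end Model

/-- `Aut₀(E)` is a normal subgroup of index 2 of `Aut(E)`, the corresponding
short exact sequence splits via an involution `ζ ∉ Aut₀(E)`, and consequently
`Aut(E) ≅ Aut₀(E) ⋊ ℤ/2 ≅ (((ℤ × ℤ) ⋊ ℤ/2) ⋊ ℤ) ⋊ ℤ/2`, where the nontrivial element of the
inner `ℤ/2` acts on `ℤ × ℤ` by multiplication by `-1`. -/
theorem stmt15 (r s t u : ℤ) (h1 : r * u - s * t = 1) (h0 : r * s * t * u ≠ 0) :
    (sapAut₀ r s t u).Normal ∧ (sapAut₀ r s t u).index = 2 ∧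
    (∃ ζ : MulAut (Sapphire r s t u), ζ ∉ sapAut₀ r s t u ∧ ζ * ζ = 1) ∧
    (∃ ψ : Multiplicative (ZMod 2) →* MulAut (sapAut₀ r s t u),
      Nonempty ((MulAut (Sapphire r s t u)) ≃*
        ((sapAut₀ r s t u) ⋊[ψ] Multiplicative (ZMod 2)))) ∧
    ∃ ψ₂ : Multiplicative (ZMod 2) →* MulAut (Multiplicative (ℤ × ℤ)),
      (∀ x : Multiplicative (ℤ × ℤ), ψ₂ (Multiplicative.ofAdd 1) x = x⁻¹) ∧
      ∃ ψ₁ : Multiplicative ℤ →*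
          MulAut (Multiplicative (ℤ × ℤ) ⋊[ψ₂] Multiplicative (ZMod 2)),
        ∃ ψ₀ : Multiplicative (ZMod 2) →*
          MulAut ((Multiplicative (ℤ × ℤ) ⋊[ψ₂] Multiplicative (ZMod 2)) ⋊[ψ₁]
            Multiplicative ℤ),
        Nonempty ((MulAut (Sapphire r s t u)) ≃*
          (((Multiplicative (ℤ × ℤ) ⋊[ψ₂] Multiplicative (ZMod 2)) ⋊[ψ₁]
            Multiplicative ℤ) ⋊[ψ₀] Multiplicative (ZMod 2))) := by
  obtain ⟨ζ, hζ, hζv⟩ := exists_flip_aut h1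
  have hζ₀ := flip_notMem_sapAut₀ h1 h0 hζv
  have hindex : (sapAut₀ r s t u).index = 2 := by
    refine Subgroup.index_eq_two_iff.2 ⟨ζ, fun φ => ?_⟩
    by_cases hφ : φ ∈ sapAut₀ r s t u
    · exact .inr ⟨hφ, fun h => hζ₀ ((Subgroup.mul_mem_cancel_left _ hφ).1 h)⟩
    · exact .inl ⟨mul_mem_sapAut₀ h1 h0 hφ hζ₀, hφ⟩
  have hnormal : (sapAut₀ r s t u).Normal := Subgroup.normal_of_index_eq_two hindex
  obtain ⟨ψ₂, hψ₂, ψ₁, j, hj, hjr⟩ := exists_sapAut₀_equiv h1 h0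
  refine ⟨hnormal, hindex, ⟨ζ, hζ₀, hζ⟩, ?_, ψ₂, hψ₂, ψ₁, ?_⟩
  · have hr := (sapAut₀ r s t u).range_subtype
    exact exists_mulEquiv_semidirectProduct_zmod_two (Subgroup.subtype_injective _) hζ
      (by rwa [hr]) (fun g hg => by rw [hr] at hg ⊢; exact mul_mem_sapAut₀ h1 h0 hg hζ₀)
      (by rwa [hr])
  · exact exists_mulEquiv_semidirectProduct_zmod_two hj hζ
      (by rwa [hjr]) (fun g hg => by rw [hjr] at hg ⊢; exact mul_mem_sapAut₀ h1 h0 hg hζ₀)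
      (by rwa [hjr])
end

section
/- Let E be the sapphire group determined by integers r, s, t, u with ru − st = 1 and rstu ≠ 0, and suppose that there is no automorphism φ of E such that φ maps the subgroup ⟨d, b⟩ onto itself, φ(v) ∈ ⟨d, b⟩·v and φ(a) ∈ ⟨d, b⟩·v·a (that is, Aut₀¹(E) = ∅). Then Out(E) = Aut(E)/Inn(E) is isomorphic to the semidirect product (ℤ/2 × C) ⋊ ℤ/2, where C is a cyclic group of order 2|s| and the nontrivial element of ℤ/2 acts on ℤ/2 × C by inversion. -/
open Matrix SemidirectProduct Multiplicative

/-- The inner automorphisms form a normal subgroup of `Aut(G)`. -/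
instance innConjNormal (G : Type*) [Group G] :
    ((MulAut.conj : G →* MulAut G).range).Normal := by
  constructor
  intro x hx φ
  obtain ⟨g, rfl⟩ := hx
  refine ⟨φ g, ?_⟩
  ext h
  simp [MulAut.conj, mul_assoc]

/-- The outer automorphism group `Out(G) = Aut(G)/Inn(G)`. -/
abbrev OutG (G : Type*) [Group G] : Type _ :=
  MulAut G ⧸ (MulAut.conj : G →* MulAut G).range

namespace Sapphire

section Lift

variable {r s t u : ℤ} {H : Type*} [Group H]

/-- The universal property of the sapphire group. -/
def lift (d b v a : H) (hdb : d * b = b * d)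
    (hvd : v * d * v⁻¹ = d ^ (r * u + s * t) * b ^ (-(2 * s * u)))
    (hvb : v * b * v⁻¹ = d ^ (-(2 * r * t)) * b ^ (r * u + s * t))
    (haa : a ^ 2 = d) (hab : a * b * a⁻¹ = b⁻¹)
    (hav : a * v * a⁻¹ = d ^ (r - r * u - s * t) * b ^ (s - 2 * s * u) * v⁻¹) :
    Sapphire r s t u →* H :=
  PresentedGroup.toGroup (f := ![d, b, v, a]) (by
    intro x hx
    simp only [sapphireRels, Set.mem_insert_iff, Set.mem_singleton_iff] at hx
    rcases hx with rfl | rfl | rfl | rfl | rfl | rfl <;>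
      simp [hdb, hvd, hvb, haa, hab, hav])

variable (d b v a : H) (hdb : d * b = b * d)
    (hvd : v * d * v⁻¹ = d ^ (r * u + s * t) * b ^ (-(2 * s * u)))
    (hvb : v * b * v⁻¹ = d ^ (-(2 * r * t)) * b ^ (r * u + s * t))
    (haa : a ^ 2 = d) (hab : a * b * a⁻¹ = b⁻¹)
    (hav : a * v * a⁻¹ = d ^ (r - r * u - s * t) * b ^ (s - 2 * s * u) * v⁻¹)

@[simp]
theorem lift_d : lift d b v a hdb hvd hvb haa hab hav (sapd r s t u) = d :=
  PresentedGroup.toGroup.of _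

@[simp]
theorem lift_b : lift d b v a hdb hvd hvb haa hab hav (sapb r s t u) = b :=
  PresentedGroup.toGroup.of _

@[simp]
theorem lift_v : lift d b v a hdb hvd hvb haa hab hav (sapv r s t u) = v :=
  PresentedGroup.toGroup.of _

@[simp]
theorem lift_a : lift d b v a hdb hvd hvb haa hab hav (sapa r s t u) = a :=
  PresentedGroup.toGroup.of _

theorem hom_ext_s16 {f g : Sapphire r s t u →* H} (hv : f (sapv r s t u) = g (sapv r s t u))
    (ha : f (sapa r s t u) = g (sapa r s t u)) (hb : f (sapb r s t u) = g (sapb r s t u))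
    (hd : f (sapd r s t u) = g (sapd r s t u)) : f = g := by
  apply PresentedGroup.ext
  intro x
  fin_cases x
  exacts [hd, hb, hv, ha]

end Lift

section Relations

variable {r s t u : ℤ}

theorem rel_eq_one {x : FreeGroup (Fin 4)} (hx : x ∈ sapphireRels r s t u) :
    PresentedGroup.mk (sapphireRels r s t u) x = 1 :=
  PresentedGroup.one_of_mem hx

theorem d_mul_b : sapd r s t u * sapb r s t u = sapb r s t u * sapd r s t u := by
  have h : sapd r s t u * sapb r s t u * (sapd r s t u)⁻¹ * (sapb r s t u)⁻¹ = 1 :=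
    rel_eq_one (Or.inl rfl)
  rwa [mul_inv_eq_one, mul_inv_eq_iff_eq_mul] at h

theorem v_conj_d : sapv r s t u * sapd r s t u * (sapv r s t u)⁻¹ =
    sapd r s t u ^ (r * u + s * t) * sapb r s t u ^ (-(2 * s * u)) :=
  mul_inv_eq_one.1 (rel_eq_one (Or.inr (Or.inl rfl)))

theorem v_conj_b : sapv r s t u * sapb r s t u * (sapv r s t u)⁻¹ =
    sapd r s t u ^ (-(2 * r * t)) * sapb r s t u ^ (r * u + s * t) :=
  mul_inv_eq_one.1 (rel_eq_one (Or.inr (Or.inr (Or.inl rfl))))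

theorem a_sq : sapa r s t u ^ 2 = sapd r s t u :=
  mul_inv_eq_one.1 (rel_eq_one (Or.inr (Or.inr (Or.inr (Or.inl rfl)))))

theorem a_conj_b : sapa r s t u * sapb r s t u * (sapa r s t u)⁻¹ = (sapb r s t u)⁻¹ :=
  eq_inv_of_mul_eq_one_left (rel_eq_one (Or.inr (Or.inr (Or.inr (Or.inr (Or.inl rfl))))))

theorem a_conj_v : sapa r s t u * sapv r s t u * (sapa r s t u)⁻¹ =
    sapd r s t u ^ (r - r * u - s * t) * sapb r s t u ^ (s - 2 * s * u) * (sapv r s t u)⁻¹ :=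
  mul_inv_eq_one.1 (rel_eq_one (Or.inr (Or.inr (Or.inr (Or.inr (Or.inr rfl))))))

theorem a_conj_d : sapa r s t u * sapd r s t u * (sapa r s t u)⁻¹ = sapd r s t u := by
  rw [← a_sq]; group

end Relations

section Translations

variable (r s t u : ℤ)

/-- The element `dⁱ bʲ` of the sapphire group. -/
def trans (i j : ℤ) : Sapphire r s t u := sapd r s t u ^ i * sapb r s t u ^ j

theorem trans_mul (i j k l : ℤ) :
    trans r s t u i j * trans r s t u k l = trans r s t u (i + k) (j + l) := by
  have h : Commute (sapb r s t u ^ j) (sapd r s t u ^ k) :=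
    (Commute.zpow_zpow (d_mul_b (r := r) (s := s) (t := t) (u := u)) k j).symm
  simp only [trans, _root_.zpow_add]
  rw [mul_assoc, ← mul_assoc (sapb r s t u ^ j), h.eq]
  simp only [mul_assoc]

theorem trans_zero : trans r s t u 0 0 = 1 := by simp [trans]

theorem trans_one_zero : trans r s t u 1 0 = sapd r s t u := by simp [trans]

theorem trans_zero_one : trans r s t u 0 1 = sapb r s t u := by simp [trans]

theorem trans_inv (i j : ℤ) : (trans r s t u i j)⁻¹ = trans r s t u (-i) (-j) := by
  rw [inv_eq_iff_mul_eq_one, trans_mul, add_neg_cancel, add_neg_cancel, trans_zero]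

theorem trans_zpow (i j k : ℤ) : trans r s t u i j ^ k = trans r s t u (k * i) (k * j) := by
  have h : Commute (sapd r s t u ^ i) (sapb r s t u ^ j) :=
    Commute.zpow_zpow (d_mul_b (r := r) (s := s) (t := t) (u := u)) i j
  rw [trans, h.mul_zpow, ← _root_.zpow_mul, ← _root_.zpow_mul, mul_comm i, mul_comm j, trans]

theorem map_trans {H : Type*} [Group H] (f : Sapphire r s t u →* H) (i j : ℤ) :
    f (trans r s t u i j) = f (sapd r s t u) ^ i * f (sapb r s t u) ^ j := by
  simp [trans]

theorem trans_mem (i j : ℤ) : trans r s t u i j ∈ sapDB r s t u :=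
  mul_mem (zpow_mem (Subgroup.subset_closure (by simp)) i)
    (zpow_mem (Subgroup.subset_closure (by simp)) j)

theorem mem_sapDB_iff {x : Sapphire r s t u} :
    x ∈ sapDB r s t u ↔ ∃ i j, x = trans r s t u i j := by
  constructor
  · intro hx
    induction hx using Subgroup.closure_induction with
    | mem x hx =>
      rcases hx with rfl | rfl
      · exact ⟨1, 0, (trans_one_zero r s t u).symm⟩
      · exact ⟨0, 1, (trans_zero_one r s t u).symm⟩
    | one => exact ⟨0, 0, (trans_zero r s t u).symm⟩
    | mul x y _ _ hx hy =>
      obtain ⟨i, j, rfl⟩ := hx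
      obtain ⟨k, l, rfl⟩ := hy
      exact ⟨_, _, trans_mul r s t u i j k l⟩
    | inv x _ hx =>
      obtain ⟨i, j, rfl⟩ := hx
      exact ⟨_, _, trans_inv r s t u i j⟩
  · rintro ⟨i, j, rfl⟩
    exact trans_mem r s t u i j

theorem v_conj_trans (i j : ℤ) :
    sapv r s t u * trans r s t u i j * (sapv r s t u)⁻¹ =
      trans r s t u ((r * u + s * t) * i - 2 * r * t * j)
        ((r * u + s * t) * j - 2 * s * u * i) := by
  have h := map_trans r s t u (MulAut.conj (sapv r s t u)).toMonoidHom i j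
  simp only [MulEquiv.toMonoidHom_eq_coe, MonoidHom.coe_coe, MulAut.conj_apply] at h
  rw [h, v_conj_d, v_conj_b]
  change trans r s t u _ _ ^ i * trans r s t u _ _ ^ j = _
  rw [trans_zpow, trans_zpow, trans_mul]
  congr 1 <;> ring

theorem a_conj_trans (i j : ℤ) :
    sapa r s t u * trans r s t u i j * (sapa r s t u)⁻¹ = trans r s t u i (-j) := by
  have h := map_trans r s t u (MulAut.conj (sapa r s t u)).toMonoidHom i j
  simp only [MulEquiv.toMonoidHom_eq_coe, MonoidHom.coe_coe, MulAut.conj_apply] at h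
  rw [h, a_conj_d, a_conj_b, trans, _root_.inv_zpow, _root_.zpow_neg]

theorem a_mul_trans (i j : ℤ) :
    sapa r s t u * trans r s t u i j = trans r s t u i (-j) * sapa r s t u := by
  rw [← a_conj_trans, inv_mul_cancel_right]

theorem v_mul_trans (i j : ℤ) :
    sapv r s t u * trans r s t u i j =
      trans r s t u ((r * u + s * t) * i - 2 * r * t * j)
        ((r * u + s * t) * j - 2 * s * u * i) * sapv r s t u := by
  rw [← v_conj_trans, inv_mul_cancel_right]

theorem a_mul_a : sapa r s t u * sapa r s t u = trans r s t u 1 0 := by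
  rw [← pow_two, a_sq, trans_one_zero]

end Translations

section Arith

variable {r s t u : ℤ}

theorem v_inv_conj_trans (h1 : r * u - s * t = 1) (i j : ℤ) :
    (sapv r s t u)⁻¹ * trans r s t u i j * sapv r s t u =
      trans r s t u ((r * u + s * t) * i + 2 * r * t * j)
        ((r * u + s * t) * j + 2 * s * u * i) := by
  rw [mul_assoc, inv_mul_eq_iff_eq_mul, v_mul_trans]
  congr 2
  · linear_combination (-i * (r * u - s * t + 1)) * h1
  · linear_combination (-j * (r * u - s * t + 1)) * h1

theorem v_inv_mul_trans (h1 : r * u - s * t = 1) (i j : ℤ) :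
    (sapv r s t u)⁻¹ * trans r s t u i j =
      trans r s t u ((r * u + s * t) * i + 2 * r * t * j)
        ((r * u + s * t) * j + 2 * s * u * i) * (sapv r s t u)⁻¹ := by
  rw [← v_inv_conj_trans h1, mul_inv_cancel_right]

end Arith

section Faithful

variable {r s t u : ℤ}

/-- The integral affine map by which `v` acts on the plane. -/
def affineV (h1 : r * u - s * t = 1) : Equiv.Perm (ℤ × ℤ) where
  toFun p := ((r * u + s * t) * p.1 - 2 * r * t * p.2 + (r - 1),
    (r * u + s * t) * p.2 - 2 * s * u * p.1 - s)
  invFun p := ((r * u + s * t) * (p.1 - (r - 1)) + 2 * r * t * (p.2 + s),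
    (r * u + s * t) * (p.2 + s) + 2 * s * u * (p.1 - (r - 1)))
  left_inv p := by
    ext
    · linear_combination (p.1 * (r * u - s * t + 1)) * h1
    · linear_combination (p.2 * (r * u - s * t + 1)) * h1
  right_inv p := by
    ext
    · linear_combination ((p.1 - (r - 1)) * (r * u - s * t + 1)) * h1
    · linear_combination ((p.2 + s) * (r * u - s * t + 1)) * h1

/-- The integral affine map by which `a` acts on the plane. -/
def affineA : Equiv.Perm (ℤ × ℤ) where
  toFun p := (p.1 + 1, -p.2)
  invFun p := (p.1 - 1, -p.2)
  left_inv p := by simp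
  right_inv p := by simp

/-- The affine action of the sapphire group on the integral plane. -/
def affineHom (h1 : r * u - s * t = 1) : Sapphire r s t u →* Equiv.Perm (ℤ × ℤ) :=
  lift (Equiv.addRight (2, 0)) (Equiv.addRight (0, 2)) (affineV h1) affineA
    (by ext p <;> simp)
    (by
      rw [mul_inv_eq_iff_eq_mul]
      ext p <;> simp [affineV] <;> ring)
    (by
      rw [mul_inv_eq_iff_eq_mul]
      ext p <;> simp [affineV] <;> ring)
    (by
      ext p <;> simp [affineA, pow_two]
      ring)
    (by
      rw [mul_inv_eq_iff_eq_mul]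
      ext p <;> simp [affineA, Equiv.Perm.inv_def]
      ring)
    (by
      rw [mul_inv_eq_iff_eq_mul]
      ext p <;> simp [affineA, affineV, Equiv.Perm.inv_def]
      · linear_combination r * h1
      · linear_combination s * h1)

theorem trans_injective (h1 : r * u - s * t = 1) {i j k l : ℤ}
    (h : trans r s t u i j = trans r s t u k l) : i = k ∧ j = l := by
  have h' := congrArg (fun x => affineHom h1 x (0, 0)) h
  simpa [map_trans, affineHom] using h'

/-- The quotient map to the infinite dihedral group. -/
def toDihedral : Sapphire r s t u →* DihedralGroup 0 :=
  lift 1 1 (DihedralGroup.r 1) (DihedralGroup.sr 0) (by simp) (by simp) (by simp)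
    (by simp [pow_two]) (by simp) (by simp)

@[simp]
theorem toDihedral_v : toDihedral (sapv r s t u) = DihedralGroup.r 1 := by simp [toDihedral]

@[simp]
theorem toDihedral_a : toDihedral (sapa r s t u) = DihedralGroup.sr 0 := by simp [toDihedral]

@[simp]
theorem toDihedral_trans (i j : ℤ) : toDihedral (trans r s t u i j) = 1 := by
  simp [toDihedral, map_trans]

theorem dihedral_r_one_zpow (k : ℤ) :
    (DihedralGroup.r 1 : DihedralGroup 0) ^ k = DihedralGroup.r (Int.cast k) := by
  simp

theorem exists_normal_form (h1 : r * u - s * t = 1) (x : Sapphire r s t u) :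
    ∃ i j k : ℤ, x = trans r s t u i j * sapv r s t u ^ k ∨
      x = trans r s t u i j * sapv r s t u ^ k * sapa r s t u := by
  have hv : ∀ k i j : ℤ, ∃ i' j', sapv r s t u ^ k * trans r s t u i j =
      trans r s t u i' j' * sapv r s t u ^ k := by
    intro k
    induction k using Int.induction_on with
    | zero => exact fun i j => ⟨i, j, by simp⟩
    | succ n ih =>
      intro i j
      obtain ⟨i', j', h⟩ := ih ((r * u + s * t) * i - 2 * r * t * j)
        ((r * u + s * t) * j - 2 * s * u * i)
      exact ⟨i', j', by rw [_root_.zpow_add_one, mul_assoc, v_mul_trans, ← mul_assoc, h, mul_assoc]⟩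
    | pred n ih =>
      intro i j
      obtain ⟨i', j', h⟩ := ih ((r * u + s * t) * i + 2 * r * t * j)
        ((r * u + s * t) * j + 2 * s * u * i)
      exact ⟨i', j', by
        rw [_root_.zpow_sub_one, mul_assoc, v_inv_mul_trans h1, ← mul_assoc, h, mul_assoc]⟩
  obtain ⟨w₁, w₂, ha_v⟩ : ∃ w₁ w₂, sapa r s t u * sapv r s t u =
      trans r s t u w₁ w₂ * (sapv r s t u)⁻¹ * sapa r s t u :=
    ⟨_, _, by rw [← mul_inv_eq_iff_eq_mul, a_conj_v, ← trans]⟩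
  have hav : ∀ k : ℤ, ∃ i j, sapa r s t u * sapv r s t u ^ k =
      trans r s t u i j * sapv r s t u ^ (-k) * sapa r s t u := by
    intro k
    induction k using Int.induction_on with
    | zero => exact ⟨0, 0, by simp [trans_zero]⟩
    | succ n ih =>
      obtain ⟨i, j, h⟩ := ih
      obtain ⟨i', j', h'⟩ := hv (-n) w₁ w₂
      refine ⟨i + i', j + j', ?_⟩
      rw [_root_.zpow_add_one, ← mul_assoc, h, mul_assoc _ (sapa r s t u), ha_v, ← trans_mul,
        show -((n : ℤ) + 1) = -n - 1 by ring, _root_.zpow_sub_one]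
      simp only [mul_assoc]
      rw [← mul_assoc (sapv r s t u ^ (-(n : ℤ))), h']
      simp only [mul_assoc]
    | pred n ih =>
      obtain ⟨i, j, h⟩ := ih
      obtain ⟨i', j', h'⟩ := hv (-(-(n : ℤ)) + 1) (-w₁) (-w₂)
      refine ⟨i + i', j + j', ?_⟩
      have h2 : sapa r s t u * (sapv r s t u)⁻¹ = sapv r s t u *
          trans r s t u (-w₁) (-w₂) * sapa r s t u := by
        rw [mul_inv_eq_iff_eq_mul, mul_assoc _ (sapa r s t u), ha_v, ← trans_inv]
        group
      rw [_root_.zpow_sub_one, ← mul_assoc, h, mul_assoc _ (sapa r s t u), h2, ← trans_mul,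
        show -(-(n : ℤ) - 1) = -(-(n : ℤ)) + 1 by ring]
      rw [mul_assoc (trans r s t u i j) (trans r s t u i' j'), ← h', _root_.zpow_add_one]
      simp only [mul_assoc]
  have hva : ∀ i j k : ℤ, ∃ i' j' k' : ℤ, (sapa r s t u * (trans r s t u i j * sapv r s t u ^ k)) =
      trans r s t u i' j' * sapv r s t u ^ k' * sapa r s t u := by
    intro i j k
    obtain ⟨i', j', h⟩ := hav k
    exact ⟨i + i', -j + j', -k, by rw [← mul_assoc, a_mul_trans, mul_assoc, h, ← trans_mul]; group⟩
  have hva2 : ∀ i j k : ℤ, ∃ i' j' k' : ℤ,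
      (sapa r s t u * (trans r s t u i j * sapv r s t u ^ k * sapa r s t u)) =
      trans r s t u i' j' * sapv r s t u ^ k' := by
    intro i j k
    obtain ⟨i', j', k', h⟩ := hva i j k
    obtain ⟨i'', j'', h''⟩ := hv k' 1 0
    refine ⟨i' + i'', j' + j'', k', ?_⟩
    rw [← mul_assoc, h, mul_assoc _ (sapa r s t u), a_mul_a, mul_assoc, h'', ← trans_mul, mul_assoc]
  let S : Set (Sapphire r s t u) := {x | ∃ i j k : ℤ, x = trans r s t u i j * sapv r s t u ^ k ∨
      x = trans r s t u i j * sapv r s t u ^ k * sapa r s t u}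
  have ht : ∀ i j, ∀ y ∈ S, trans r s t u i j * y ∈ S := by
    rintro i j y ⟨i', j', k, rfl | rfl⟩
    · exact ⟨i + i', j + j', k, Or.inl (by rw [← trans_mul, mul_assoc])⟩
    · exact ⟨i + i', j + j', k, Or.inr (by rw [← trans_mul]; simp only [mul_assoc])⟩
  have hvS : ∀ y ∈ S, sapv r s t u * y ∈ S := by
    rintro y ⟨i', j', k, rfl | rfl⟩
    · exact ⟨_, _, 1 + k, Or.inl (by
        rw [← mul_assoc, v_mul_trans, _root_.zpow_add, _root_.zpow_one, mul_assoc])⟩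
    · exact ⟨_, _, 1 + k, Or.inr (by
        rw [← mul_assoc, ← mul_assoc, v_mul_trans, _root_.zpow_add, _root_.zpow_one,
          mul_assoc (trans r s t u _ _) (sapv r s t u)])⟩
  have hvS' : ∀ y ∈ S, (sapv r s t u)⁻¹ * y ∈ S := by
    rintro y ⟨i', j', k, rfl | rfl⟩
    · exact ⟨_, _, -1 + k, Or.inl (by
        rw [← mul_assoc, v_inv_mul_trans h1, _root_.zpow_add, _root_.zpow_neg_one, mul_assoc])⟩
    · exact ⟨_, _, -1 + k, Or.inr (by
        rw [← mul_assoc, ← mul_assoc, v_inv_mul_trans h1, _root_.zpow_add, _root_.zpow_neg_one,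
          mul_assoc (trans r s t u _ _) (sapv r s t u)⁻¹])⟩
  have haS : ∀ y ∈ S, sapa r s t u * y ∈ S := by
    rintro y ⟨i', j', k, rfl | rfl⟩
    · obtain ⟨i, j, k', h⟩ := hva i' j' k
      exact ⟨i, j, k', Or.inr h⟩
    · obtain ⟨i, j, k', h⟩ := hva2 i' j' k
      exact ⟨i, j, k', Or.inl h⟩
  have hd : sapd r s t u = trans r s t u 1 0 := (trans_one_zero r s t u).symm
  have hb : sapb r s t u = trans r s t u 0 1 := (trans_zero_one r s t u).symm
  have haS' : ∀ y ∈ S, (sapa r s t u)⁻¹ * y ∈ S := by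
    intro y hy
    have : (sapa r s t u)⁻¹ = trans r s t u (-1) (-0) * sapa r s t u := by
      rw [← trans_inv, ← a_mul_a]; group
    rw [this, mul_assoc]
    exact ht _ _ _ (haS _ hy)
  have hx : x ∈ Subgroup.closure (Set.range (PresentedGroup.of (rels := sapphireRels r s t u))) := by
    rw [PresentedGroup.closure_range_of]; trivial
  change x ∈ S
  induction hx using Subgroup.closure_induction_left with
  | one => exact ⟨0, 0, 0, Or.inl (by simp [trans_zero])⟩
  | mul_left y hy z _ hz =>
    obtain ⟨n, rfl⟩ := hy
    fin_cases n
    · change sapd r s t u * z ∈ S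
      rw [hd]; exact ht _ _ _ hz
    · change sapb r s t u * z ∈ S
      rw [hb]; exact ht _ _ _ hz
    · exact hvS _ hz
    · exact haS _ hz
  | inv_mul_cancel y hy z _ hz =>
    obtain ⟨n, rfl⟩ := hy
    fin_cases n
    · change (sapd r s t u)⁻¹ * z ∈ S
      rw [hd, trans_inv]; exact ht _ _ _ hz
    · change (sapb r s t u)⁻¹ * z ∈ S
      rw [hb, trans_inv]; exact ht _ _ _ hz
    · exact hvS' _ hz
    · exact haS' _ hz

theorem toDihedral_normal_form (i j k : ℤ) :
    toDihedral (trans r s t u i j * sapv r s t u ^ k) = DihedralGroup.r (Int.cast k) := by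
  rw [map_mul, map_zpow, toDihedral_trans, toDihedral_v, one_mul, dihedral_r_one_zpow]

theorem toDihedral_normal_form' (i j k : ℤ) :
    toDihedral (trans r s t u i j * sapv r s t u ^ k * sapa r s t u) = DihedralGroup.sr (Int.cast (-k)) := by
  rw [map_mul, toDihedral_normal_form, toDihedral_a]; simp

theorem ker_toDihedral (h1 : r * u - s * t = 1) :
    (toDihedral : Sapphire r s t u →* _).ker = sapDB r s t u := by
  ext x
  rw [MonoidHom.mem_ker, mem_sapDB_iff]
  constructor
  · intro hx
    obtain ⟨i, j, k, rfl | rfl⟩ := exists_normal_form h1 x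
    · rw [toDihedral_normal_form, DihedralGroup.one_def, DihedralGroup.r.injEq] at hx
      rw [Int.cast_eq_zero] at hx
      exact ⟨i, j, by simp [hx]⟩
    · rw [toDihedral_normal_form', DihedralGroup.one_def] at hx
      cases hx
  · rintro ⟨i, j, rfl⟩
    exact toDihedral_trans i j

end Faithful

section Action

variable {r s t u : ℤ}

/-- The element `x` acts on `⟨d, b⟩` by conjugation through the matrix
`[[p, -2 r t σ q], [-2 s u q, σp]]`. -/
def HasAct (x : Sapphire r s t u) (p q σ : ℤ) : Prop :=
  ∀ i j, x * trans r s t u i j * x⁻¹ =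
    trans r s t u (p * i - 2 * r * t * (σ * q) * j) (σ * p * j - 2 * s * u * q * i)

theorem HasAct.mul_a {x : Sapphire r s t u} {p q σ : ℤ} (h : HasAct x p q σ) :
    HasAct (x * sapa r s t u) p q (-σ) := by
  intro i j
  have h' := h i (-j)
  rw [← a_conj_trans] at h'
  rw [show x * sapa r s t u * trans r s t u i j * (x * sapa r s t u)⁻¹ =
    x * (sapa r s t u * trans r s t u i j * (sapa r s t u)⁻¹) * x⁻¹ by group, h']
  congr 1 <;> ring

theorem HasAct.trans_mul {x : Sapphire r s t u} {p q σ : ℤ} (h : HasAct x p q σ) (k l : ℤ) :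
    HasAct (trans r s t u k l * x) p q σ := by
  intro i j
  rw [show trans r s t u k l * x * trans r s t u i j * (trans r s t u k l * x)⁻¹ =
    trans r s t u k l * (x * trans r s t u i j * x⁻¹) * (trans r s t u k l)⁻¹ by group, h,
    trans_inv, Sapphire.trans_mul, Sapphire.trans_mul]
  congr 1 <;> ring

theorem discriminant_pos (h1 : r * u - s * t = 1) (h0 : r * s * t * u ≠ 0) : 0 < r * s * t * u := by
  have h : (r * u + s * t) ^ 2 = 1 + 4 * (r * s * t * u) := by
    linear_combination (r * u - s * t + 1) * h1
  have := sq_nonneg (r * u + s * t)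
  omega

theorem exists_hasAct_pow (h1 : r * u - s * t = 1) (h0 : r * s * t * u ≠ 0) (n : ℕ) :
    ∃ p q, p ^ 2 - 4 * (r * s * t * u) * q ^ 2 = 1 ∧ 0 ≤ (r * u + s * t) * p * q ∧
      (n ≠ 0 → q ≠ 0) ∧ (n = 0 → p = 1 ∧ q = 0) ∧ HasAct (sapv r s t u ^ n) p q 1 ∧
      HasAct (sapv r s t u ^ n)⁻¹ p (-q) 1 := by
  have hD := discriminant_pos h1 h0
  have hA : (r * u + s * t) ^ 2 = 1 + 4 * (r * s * t * u) := by
    linear_combination (r * u - s * t + 1) * h1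
  induction n with
  | zero => exact ⟨1, 0, by simp, by simp, by simp, by simp, fun i j => by simp, fun i j => by simp⟩
  | succ n ih =>
    obtain ⟨p, q, hpq, hpos, -, -, hact, hact'⟩ := ih
    have hp : 0 < p ^ 2 := by nlinarith [mul_nonneg hD.le (sq_nonneg q)]
    have hpos' : 0 < (r * u + s * t) * ((r * u + s * t) * p + 4 * (r * s * t * u) * q) *
        (p + (r * u + s * t) * q) := by
      have e : (r * u + s * t) * ((r * u + s * t) * p + 4 * (r * s * t * u) * q) *
        (p + (r * u + s * t) * q) = (r * u + s * t) ^ 2 * p ^ 2 +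
          (r * u + s * t) ^ 2 * (4 * (r * s * t * u) * q ^ 2) +
          ((r * u + s * t) ^ 2 + 4 * (r * s * t * u)) * ((r * u + s * t) * p * q) := by ring
      rw [e, hA]
      positivity
    refine ⟨(r * u + s * t) * p + 4 * (r * s * t * u) * q, p + (r * u + s * t) * q, ?_, hpos'.le,
      ?_, by simp, ?_, ?_⟩
    · linear_combination hpq + (p ^ 2 - 4 * (r * s * t * u) * q ^ 2) * hA
    · rintro - h
      rw [h, mul_zero] at hpos'
      exact hpos'.ne rfl
    · intro i j
      rw [pow_succ', show sapv r s t u * sapv r s t u ^ n * trans r s t u i j *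
        (sapv r s t u * sapv r s t u ^ n)⁻¹ = sapv r s t u * (sapv r s t u ^ n * trans r s t u i j *
        (sapv r s t u ^ n)⁻¹) * (sapv r s t u)⁻¹ by group, hact, v_conj_trans]
      congr 1 <;> ring
    · intro i j
      rw [pow_succ, show (sapv r s t u ^ n * sapv r s t u)⁻¹ * trans r s t u i j *
        (sapv r s t u ^ n * sapv r s t u)⁻¹⁻¹ = (sapv r s t u)⁻¹ * ((sapv r s t u ^ n)⁻¹ *
        trans r s t u i j * (sapv r s t u ^ n)⁻¹⁻¹) * sapv r s t u by group, hact',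
        v_inv_conj_trans h1]
      congr 1 <;> ring

theorem exists_hasAct_zpow (h1 : r * u - s * t = 1) (h0 : r * s * t * u ≠ 0) (k : ℤ) :
    ∃ p q, p ^ 2 - 4 * (r * s * t * u) * q ^ 2 = 1 ∧ (k ≠ 0 → q ≠ 0) ∧ (k = 0 → p = 1) ∧
      HasAct (sapv r s t u ^ k) p q 1 := by
  obtain ⟨p, q, hpq, -, hq, hp, hact, hact'⟩ := exists_hasAct_pow h1 h0 k.natAbs
  rcases Int.natAbs_eq k with hk | hk
  · refine ⟨p, q, hpq, fun h => hq (by omega), fun h => (hp (by omega)).1, ?_⟩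
    rw [hk, _root_.zpow_natCast]
    exact hact
  · refine ⟨p, -q, by linear_combination hpq, fun h => neg_ne_zero.2 (hq (by omega)),
      fun h => (hp (by omega)).1, ?_⟩
    rw [hk, _root_.zpow_neg, _root_.zpow_natCast]
    exact hact'

theorem exists_hasAct (h1 : r * u - s * t = 1) (h0 : r * s * t * u ≠ 0) (x : Sapphire r s t u) :
    ∃ p q σ, (σ = 1 ∨ σ = -1) ∧ p ^ 2 - 4 * (r * s * t * u) * q ^ 2 = 1 ∧ HasAct x p q σ ∧
      (q = 0 → p = 1) ∧ (q = 0 → σ = 1 → x ∈ sapDB r s t u) := by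
  obtain ⟨i, j, k, hx⟩ := exists_normal_form h1 x
  obtain ⟨p, q, hpq, hq, hp, hact⟩ := exists_hasAct_zpow h1 h0 k
  have hk : q = 0 → k = 0 := fun h => by_contra fun hk => hq hk h
  rcases hx with rfl | rfl
  · refine ⟨p, q, 1, Or.inl rfl, hpq, hact.trans_mul i j, fun h => hp (hk h), fun h _ => ?_⟩
    rw [hk h, _root_.zpow_zero, mul_one]
    exact trans_mem r s t u i j
  · exact ⟨p, q, -1, Or.inr rfl, hpq, (hact.trans_mul i j).mul_a, fun h => hp (hk h),
      fun _ h => absurd h (by norm_num)⟩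

/-- An element acting on `⟨d, b⟩` by a scalar `ε = ±1` lies in `⟨d, b⟩`, and `ε = 1`. -/
theorem mem_of_act_scalar (h1 : r * u - s * t = 1) (h0 : r * s * t * u ≠ 0) {x : Sapphire r s t u}
    {ε : ℤ} (hd : x * sapd r s t u * x⁻¹ = sapd r s t u ^ ε)
    (hb : x * sapb r s t u * x⁻¹ = sapb r s t u ^ ε) : ε = 1 ∧ x ∈ sapDB r s t u := by
  obtain ⟨p, q, σ, hσ, hpq, hact, hp, hx⟩ := exists_hasAct h1 h0 x
  have hsu : 2 * s * u ≠ 0 := by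
    rintro h
    apply h0
    have : s * u = 0 := by linarith
    linear_combination (r * t) * this
  rw [← trans_one_zero, hact, trans_zpow] at hd
  rw [← trans_zero_one, hact, trans_zpow] at hb
  obtain ⟨hd1, hd2⟩ := trans_injective h1 hd
  obtain ⟨hb1, hb2⟩ := trans_injective h1 hb
  have hq : q = 0 := (mul_eq_zero.1 (show 2 * s * u * q = 0 by linarith)).resolve_left hsu
  have hp1 := hp hq
  subst hq hp1
  exact ⟨by linarith, hx rfl (by linarith)⟩

/-- `⟨d, b⟩` consists of the elements commuting with all of their conjugates. -/
theorem mem_sapDB_iff_commute (h1 : r * u - s * t = 1) (h0 : r * s * t * u ≠ 0)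
    (x : Sapphire r s t u) :
    x ∈ sapDB r s t u ↔ ∀ g, Commute x (g * x * g⁻¹) := by
  constructor
  · intro hx g
    have hg : g * x * g⁻¹ ∈ sapDB r s t u := by
      rw [← ker_toDihedral h1] at hx ⊢
      exact MonoidHom.normal_ker _ |>.conj_mem x hx g
    obtain ⟨i, j, hi⟩ := (mem_sapDB_iff r s t u).1 hx
    obtain ⟨k, l, hk⟩ := (mem_sapDB_iff r s t u).1 hg
    rw [hk, hi, commute_iff_eq, trans_mul, trans_mul, add_comm i, add_comm j]
  · intro hx
    obtain ⟨p, q, σ, hσ, hpq, hact, hp, hmem⟩ := exists_hasAct h1 h0 x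
    have hsu : s * u ≠ 0 := fun h => h0 (by linear_combination (r * t) * h)
    have key : ∀ i j, x * (trans r s t u i j * (x * trans r s t u i j * x⁻¹)⁻¹) * x⁻¹ =
        trans r s t u i j * (x * trans r s t u i j * x⁻¹)⁻¹ := by
      intro i j
      have h := hx (trans r s t u i j)
      rw [mul_inv_eq_iff_eq_mul, show trans r s t u i j * (x * trans r s t u i j * x⁻¹)⁻¹ =
        trans r s t u i j * x * (trans r s t u i j)⁻¹ * x⁻¹ by group, ← mul_assoc, h.eq]
      group
    have hd := key 1 0
    rw [hact, trans_inv, trans_mul, hact] at hd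
    obtain ⟨e1, e2⟩ := trans_injective h1 hd
    rcases hσ with rfl | rfl
    · have hq : q * (p - 1) = 0 := by
        have : s * u * (q * (p - 1)) = 0 := by linarith
        exact (mul_eq_zero.1 this).resolve_left hsu
      rcases mul_eq_zero.1 hq with hq | hq
      · exact hmem hq rfl
      · have hp1 : p = 1 := by linarith
        subst hp1
        have : r * s * t * u * q ^ 2 = 0 := by linarith
        exact hmem (pow_eq_zero_iff two_ne_zero |>.1 ((mul_eq_zero.1 this).resolve_left h0)) rfl
    · exfalso
      have hq : q = 0 := by
        have : s * u * q = 0 := by linarith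
        exact (mul_eq_zero.1 this).resolve_left hsu
      have hp1 := hp hq
      subst hq hp1
      have hb := key 0 1
      rw [hact, trans_inv, trans_mul, hact] at hb
      have := (trans_injective h1 hb).2
      norm_num at this

theorem aut_mem_iff (h1 : r * u - s * t = 1) (h0 : r * s * t * u ≠ 0)
    (φ : MulAut (Sapphire r s t u)) (x : Sapphire r s t u) :
    φ x ∈ sapDB r s t u ↔ x ∈ sapDB r s t u := by
  rw [mem_sapDB_iff_commute h1 h0, mem_sapDB_iff_commute h1 h0]
  constructor
  · intro h g
    have := (h (φ g)).map φ.symm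
    simpa using this
  · intro h g
    have := (h (φ.symm g)).map φ
    simpa using this

theorem aut_map_sapDB (h1 : r * u - s * t = 1) (h0 : r * s * t * u ≠ 0)
    (φ : MulAut (Sapphire r s t u)) :
    (sapDB r s t u).map φ.toMonoidHom = sapDB r s t u := by
  ext x
  constructor
  · rintro ⟨y, hy, rfl⟩
    exact (aut_mem_iff h1 h0 φ y).2 hy
  · intro hx
    exact ⟨φ.symm x, (aut_mem_iff h1 h0 φ.symm x).2 hx, φ.apply_symm_apply x⟩

end Action

section Quotient

variable {r s t u : ℤ}

theorem dihedral_cases (x : DihedralGroup 0) :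
    (∃ k : ℤ, x = DihedralGroup.r (Int.cast k)) ∨ ∃ k : ℤ, x = DihedralGroup.sr (Int.cast k) := by
  cases x with
  | r i =>
    obtain ⟨k, rfl⟩ := ZMod.intCast_surjective i
    exact Or.inl ⟨k, rfl⟩
  | sr i =>
    obtain ⟨k, rfl⟩ := ZMod.intCast_surjective i
    exact Or.inr ⟨k, rfl⟩

theorem dihedral_r_eq_one {k : ℤ} (h : (DihedralGroup.r (Int.cast k) : DihedralGroup 0) = 1) :
    k = 0 := by
  rw [DihedralGroup.one_def, DihedralGroup.r.injEq, Int.cast_eq_zero] at h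
  exact h

theorem toDihedral_eq_one_iff (h1 : r * u - s * t = 1) {x : Sapphire r s t u} :
    toDihedral x = 1 ↔ x ∈ sapDB r s t u := by
  rw [← ker_toDihedral h1, MonoidHom.mem_ker]

theorem exists_trans_mul (h1 : r * u - s * t = 1) {x y : Sapphire r s t u}
    (h : toDihedral x = toDihedral y) : ∃ i j, x = trans r s t u i j * y := by
  have : x * y⁻¹ ∈ sapDB r s t u := by
    rw [← toDihedral_eq_one_iff h1, map_mul, map_inv, h, mul_inv_cancel]
  obtain ⟨i, j, hij⟩ := (mem_sapDB_iff r s t u).1 this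
  exact ⟨i, j, mul_inv_eq_iff_eq_mul.1 hij⟩

theorem exists_toDihedral_aut_v (h1 : r * u - s * t = 1) (h0 : r * s * t * u ≠ 0)
    (φ : MulAut (Sapphire r s t u)) :
    ∃ k : ℤ, toDihedral (φ (sapv r s t u)) = DihedralGroup.r (Int.cast k) := by
  rcases dihedral_cases (toDihedral (φ (sapv r s t u))) with h | ⟨k, hk⟩
  · exact h
  · exfalso
    have h2 : φ (sapv r s t u * sapv r s t u) ∈ sapDB r s t u := by
      rw [← toDihedral_eq_one_iff h1, map_mul, map_mul, hk, DihedralGroup.sr_mul_sr, sub_self,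
        DihedralGroup.one_def]
    rw [aut_mem_iff h1 h0, ← toDihedral_eq_one_iff h1, ← pow_two, map_pow, toDihedral_v,
      ← _root_.zpow_natCast, dihedral_r_one_zpow] at h2
    have := dihedral_r_eq_one h2
    omega

theorem exists_toDihedral_aut_a (h1 : r * u - s * t = 1) (h0 : r * s * t * u ≠ 0)
    (φ : MulAut (Sapphire r s t u)) :
    ∃ k : ℤ, toDihedral (φ (sapa r s t u)) = DihedralGroup.sr (Int.cast k) := by
  rcases dihedral_cases (toDihedral (φ (sapa r s t u))) with ⟨k, hk⟩ | h
  · exfalso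
    have h2 : φ (sapa r s t u * sapa r s t u) ∈ sapDB r s t u := by
      rw [aut_mem_iff h1 h0, a_mul_a]
      exact trans_mem r s t u 1 0
    rw [← toDihedral_eq_one_iff h1, map_mul, map_mul, hk, DihedralGroup.r_mul_r,
      ← Int.cast_add] at h2
    have hk0 := dihedral_r_eq_one h2
    have hk0 : k = 0 := by omega
    subst hk0
    have h3 : φ (sapa r s t u) ∈ sapDB r s t u := by
      rw [← toDihedral_eq_one_iff h1, hk, Int.cast_zero, DihedralGroup.one_def]
    rw [aut_mem_iff h1 h0, ← toDihedral_eq_one_iff h1, toDihedral_a, DihedralGroup.one_def] at h3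
    cases h3
  · exact h

theorem toDihedral_aut_v (h1 : r * u - s * t = 1) (h0 : r * s * t * u ≠ 0)
    (φ : MulAut (Sapphire r s t u)) :
    toDihedral (φ (sapv r s t u)) = DihedralGroup.r 1 ∨
      toDihedral (φ (sapv r s t u)) = DihedralGroup.r (-1) := by
  obtain ⟨k, hk⟩ := exists_toDihedral_aut_v h1 h0 φ
  obtain ⟨l, hl⟩ := exists_toDihedral_aut_v h1 h0 φ⁻¹
  have h : φ (φ⁻¹ (sapv r s t u) * (sapv r s t u ^ l)⁻¹) ∈ sapDB r s t u := by
    rw [aut_mem_iff h1 h0, ← toDihedral_eq_one_iff h1, map_mul, map_inv, map_zpow, hl,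
      toDihedral_v, dihedral_r_one_zpow, mul_inv_cancel]
  rw [map_mul, MulAut.apply_inv_self, map_inv, map_zpow, ← toDihedral_eq_one_iff h1, map_mul,
    map_inv, map_zpow, hk, toDihedral_v, ← dihedral_r_one_zpow, ← _root_.zpow_mul,
    ← _root_.zpow_neg, ← _root_.zpow_one_add, dihedral_r_one_zpow] at h
  have hkl : k * l = 1 := by linarith [dihedral_r_eq_one h]
  rcases Int.eq_one_or_neg_one_of_mul_eq_one hkl with rfl | rfl
  · exact Or.inl (by simpa using hk)
  · exact Or.inr (by simpa using hk)

/-- Up to inner automorphisms, an automorphism acts on the infinite dihedral quotient either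
trivially or by `v ↦ v`, `a ↦ va`. -/
theorem exists_conj_toDihedral (h1 : r * u - s * t = 1) (h0 : r * s * t * u ≠ 0)
    (φ : MulAut (Sapphire r s t u)) :
    ∃ g : Sapphire r s t u, toDihedral ((MulAut.conj g * φ) (sapv r s t u)) = DihedralGroup.r 1 ∧
      (toDihedral ((MulAut.conj g * φ) (sapa r s t u)) = DihedralGroup.sr 0 ∨
        toDihedral ((MulAut.conj g * φ) (sapa r s t u)) = DihedralGroup.sr (-1)) := by
  have key : ∀ φ : MulAut (Sapphire r s t u), toDihedral (φ (sapv r s t u)) = DihedralGroup.r 1 →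
      ∃ g : Sapphire r s t u, toDihedral ((MulAut.conj g * φ) (sapv r s t u)) = DihedralGroup.r 1 ∧
      (toDihedral ((MulAut.conj g * φ) (sapa r s t u)) = DihedralGroup.sr 0 ∨
        toDihedral ((MulAut.conj g * φ) (sapa r s t u)) = DihedralGroup.sr (-1)) := by
    intro φ hφ
    obtain ⟨m, hm⟩ := exists_toDihedral_aut_a h1 h0 φ
    have hl : ∀ l : ℤ, toDihedral (sapv r s t u ^ l) = DihedralGroup.r (Int.cast l) := fun l => by
      rw [map_zpow, toDihedral_v, dihedral_r_one_zpow]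
    have hv : ∀ l : ℤ, toDihedral ((MulAut.conj (sapv r s t u ^ l) * φ) (sapv r s t u)) =
        DihedralGroup.r 1 := fun l => by
      simp only [MulAut.mul_apply, MulAut.conj_apply, map_mul, map_inv, hl, hφ]
      simp
    have ha : ∀ l : ℤ, toDihedral ((MulAut.conj (sapv r s t u ^ l) * φ) (sapa r s t u)) =
        DihedralGroup.sr (Int.cast (m - 2 * l)) := fun l => by
      simp only [MulAut.mul_apply, MulAut.conj_apply, map_mul, map_inv, hl, hm]
      simp only [DihedralGroup.r_mul_sr, DihedralGroup.inv_r, DihedralGroup.sr_mul_r]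
      congr 1
      push_cast
      ring
    rcases Int.even_or_odd m with ⟨l, hl⟩ | ⟨l, hl⟩
    · refine ⟨_, hv l, Or.inl ?_⟩
      rw [ha, show m - 2 * l = 0 by omega, Int.cast_zero]
    · refine ⟨_, hv (l + 1), Or.inr ?_⟩
      rw [ha, show m - 2 * (l + 1) = -1 by omega, Int.cast_neg, Int.cast_one]
  rcases toDihedral_aut_v h1 h0 φ with h | h
  · exact key φ h
  · obtain ⟨g, hg⟩ := key (MulAut.conj (sapa r s t u) * φ) (by
      simp [h])
    exact ⟨g * sapa r s t u, by simpa only [map_mul, mul_assoc] using hg⟩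

theorem exists_conj_toDihedral_trivial (h1 : r * u - s * t = 1) (h0 : r * s * t * u ≠ 0)
    (hempty : ¬ ∃ φ : MulAut (Sapphire r s t u),
      (sapDB r s t u).map φ.toMonoidHom = sapDB r s t u ∧
      (∃ g ∈ sapDB r s t u, φ (sapv r s t u) = g * sapv r s t u) ∧
      (∃ g ∈ sapDB r s t u, φ (sapa r s t u) = g * sapv r s t u * sapa r s t u))
    (φ : MulAut (Sapphire r s t u)) :
    ∃ g : Sapphire r s t u, toDihedral ((MulAut.conj g * φ) (sapv r s t u)) = DihedralGroup.r 1 ∧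
      toDihedral ((MulAut.conj g * φ) (sapa r s t u)) = DihedralGroup.sr 0 := by
  obtain ⟨g, hv, ha | ha⟩ := exists_conj_toDihedral h1 h0 φ
  · exact ⟨g, hv, ha⟩
  · refine absurd ⟨_, aut_map_sapDB h1 h0 (MulAut.conj g * φ), ?_, ?_⟩ hempty
    · obtain ⟨i, j, h⟩ := exists_trans_mul h1 (y := sapv r s t u) (by rw [hv, toDihedral_v])
      exact ⟨_, trans_mem r s t u i j, h⟩
    · obtain ⟨i, j, h⟩ := exists_trans_mul h1 (y := sapv r s t u * sapa r s t u)
        (by rw [ha, map_mul, toDihedral_v, toDihedral_a]; simp)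
      exact ⟨_, trans_mem r s t u i j, by rw [h, mul_assoc]⟩

end Quotient

section Endomorphisms

variable {r s t u : ℤ}

theorem v_conj_trans_mul_v (k l i j : ℤ) :
    trans r s t u k l * sapv r s t u * trans r s t u i j * (trans r s t u k l * sapv r s t u)⁻¹ =
      trans r s t u ((r * u + s * t) * i - 2 * r * t * j)
        ((r * u + s * t) * j - 2 * s * u * i) := by
  rw [show trans r s t u k l * sapv r s t u * trans r s t u i j *
    (trans r s t u k l * sapv r s t u)⁻¹ = trans r s t u k l * (sapv r s t u * trans r s t u i j *
    (sapv r s t u)⁻¹) * (trans r s t u k l)⁻¹ by group, v_conj_trans, trans_inv, trans_mul,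
    trans_mul]
  congr 1 <;> ring

theorem a_conj_trans_mul_a (k l i j : ℤ) :
    trans r s t u k l * sapa r s t u * trans r s t u i j * (trans r s t u k l * sapa r s t u)⁻¹ =
      trans r s t u i (-j) := by
  rw [show trans r s t u k l * sapa r s t u * trans r s t u i j *
    (trans r s t u k l * sapa r s t u)⁻¹ = trans r s t u k l * (sapa r s t u * trans r s t u i j *
    (sapa r s t u)⁻¹) * (trans r s t u k l)⁻¹ by group, a_conj_trans, trans_inv, trans_mul,
    trans_mul]
  congr 1 <;> ring

theorem trans_mul_a_sq (h₁ h₂ : ℤ) :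
    (trans r s t u h₁ h₂ * sapa r s t u) ^ 2 = trans r s t u (2 * h₁ + 1) 0 := by
  rw [pow_two, mul_assoc, ← mul_assoc (sapa r s t u), a_mul_trans, mul_assoc (trans r s t u h₁ _),
    a_mul_a, trans_mul, trans_mul]
  congr 1 <;> ring

theorem a_mul_v : sapa r s t u * sapv r s t u =
    trans r s t u (r - r * u - s * t) (s - 2 * s * u) * (sapv r s t u)⁻¹ * sapa r s t u := by
  rw [← mul_inv_eq_iff_eq_mul, a_conj_v, ← trans]

theorem a_conj_v_left (h₁ h₂ g₁ g₂ : ℤ) :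
    (trans r s t u h₁ h₂ * sapa r s t u) * (trans r s t u g₁ g₂ * sapv r s t u) =
      trans r s t u (h₁ + g₁ + (r - r * u - s * t)) (h₂ - g₂ + (s - 2 * s * u)) *
        ((sapv r s t u)⁻¹ * sapa r s t u) := by
  have h := a_mul_v (r := r) (s := s) (t := t) (u := u)
  generalize r - r * u - s * t = w₁ at *
  generalize s - 2 * s * u = w₂ at *
  rw [mul_assoc (trans r s t u h₁ h₂), ← mul_assoc (sapa r s t u), a_mul_trans,
    mul_assoc (trans r s t u g₁ _), h, sub_eq_add_neg, ← trans_mul, ← trans_mul]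
  simp only [mul_assoc]

theorem a_conj_v_right (h1 : r * u - s * t = 1) (p h₁ h₂ g₁ g₂ : ℤ) :
    trans r s t u (p * (r - r * u - s * t)) (p * (s - 2 * s * u)) *
      (trans r s t u g₁ g₂ * sapv r s t u)⁻¹ * (trans r s t u h₁ h₂ * sapa r s t u) =
      trans r s t u
        (p * (r - r * u - s * t) + ((r * u + s * t) * (h₁ - g₁) + 2 * r * t * (h₂ - g₂)))
        (p * (s - 2 * s * u) + ((r * u + s * t) * (h₂ - g₂) + 2 * s * u * (h₁ - g₁))) *
        ((sapv r s t u)⁻¹ * sapa r s t u) := by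
  rw [← trans_mul]
  generalize p * (r - r * u - s * t) = w₁
  generalize p * (s - 2 * s * u) = w₂
  rw [show trans r s t u w₁ w₂ * (trans r s t u g₁ g₂ * sapv r s t u)⁻¹ *
    (trans r s t u h₁ h₂ * sapa r s t u) = trans r s t u w₁ w₂ * ((sapv r s t u)⁻¹ *
    ((trans r s t u g₁ g₂)⁻¹ * trans r s t u h₁ h₂)) * sapa r s t u by group, trans_inv, trans_mul,
    neg_add_eq_sub, neg_add_eq_sub, v_inv_mul_trans h1, ← mul_assoc, ← mul_assoc]

/-- The endomorphism of the sapphire group acting by the scalar `p = ±1` on `⟨d, b⟩` and sending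
`v` to `d^g₁ b^g₂ v` and `a` to `d^h₁ b^h₂ a`. -/
def endo (h1 : r * u - s * t = 1) (p h₁ h₂ g₁ g₂ : ℤ) (hp : p = 2 * h₁ + 1)
    (hc : u * g₁ + t * (g₂ - h₂) = -(u - 1) * h₁) : Sapphire r s t u →* Sapphire r s t u :=
  lift (trans r s t u p 0) (trans r s t u 0 p) (trans r s t u g₁ g₂ * sapv r s t u)
    (trans r s t u h₁ h₂ * sapa r s t u)
    (by rw [trans_mul, trans_mul]; congr 1 <;> ring)
    (by
      rw [v_conj_trans_mul_v, trans_zpow, trans_zpow, trans_mul]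
      congr 1 <;> ring)
    (by
      rw [v_conj_trans_mul_v, trans_zpow, trans_zpow, trans_mul]
      congr 1 <;> ring)
    (by rw [trans_mul_a_sq, hp])
    (by
      rw [a_conj_trans_mul_a, trans_inv, neg_zero])
    (by
      subst hp
      rw [mul_inv_eq_iff_eq_mul, a_conj_v_left, trans_zpow, trans_zpow, trans_mul, mul_zero,
        mul_zero, add_zero, zero_add, mul_comm _ (2 * h₁ + 1), mul_comm _ (2 * h₁ + 1),
        a_conj_v_right h1]
      congr 2
      · linear_combination 2 * r * hc - (h₁ + g₁) * h1
      · linear_combination 2 * s * hc - (h₂ - g₂) * h1)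

section EndoApply

variable (h1 : r * u - s * t = 1) (p h₁ h₂ g₁ g₂ : ℤ) (hp : p = 2 * h₁ + 1)
    (hc : u * g₁ + t * (g₂ - h₂) = -(u - 1) * h₁)

@[simp]
theorem endo_d : endo h1 p h₁ h₂ g₁ g₂ hp hc (sapd r s t u) = trans r s t u p 0 := by simp [endo]

@[simp]
theorem endo_b : endo h1 p h₁ h₂ g₁ g₂ hp hc (sapb r s t u) = trans r s t u 0 p := by simp [endo]

@[simp]
theorem endo_v : endo h1 p h₁ h₂ g₁ g₂ hp hc (sapv r s t u) =
    trans r s t u g₁ g₂ * sapv r s t u := by simp [endo]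

@[simp]
theorem endo_a : endo h1 p h₁ h₂ g₁ g₂ hp hc (sapa r s t u) =
    trans r s t u h₁ h₂ * sapa r s t u := by simp [endo]

@[simp]
theorem endo_trans (i j : ℤ) : endo h1 p h₁ h₂ g₁ g₂ hp hc (trans r s t u i j) =
    trans r s t u (p * i) (p * j) := by
  rw [map_trans, endo_d, endo_b, trans_zpow, trans_zpow, trans_mul]
  congr 1 <;> ring

end EndoApply

/-- The automorphism fixing `d` and `b` with `v ↦ d^(t(rα+β)) b^(α-u(rα+β)) v`, `a ↦ b^α a`. -/
def transEndo (h1 : r * u - s * t = 1) (x : ℤ × ℤ) : Sapphire r s t u →* Sapphire r s t u :=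
  endo h1 1 0 x.1 (t * (r * x.1 + x.2)) (x.1 - u * (r * x.1 + x.2)) (by ring) (by ring)

theorem transEndo_comp (h1 : r * u - s * t = 1) (x y : ℤ × ℤ) :
    (transEndo h1 x).comp (transEndo h1 y) = transEndo h1 (x + y) := by
  apply hom_ext_s16 <;>
    simp only [transEndo, MonoidHom.comp_apply, endo_v, endo_a, endo_b, endo_d, endo_trans, map_mul,
      ← mul_assoc, trans_mul, Prod.fst_add, Prod.snd_add]
  · congr 2 <;> ring
  · congr 2; ring
  · simp
  · simp

theorem transEndo_zero (h1 : r * u - s * t = 1) :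
    transEndo h1 0 = MonoidHom.id (Sapphire r s t u) := by
  apply hom_ext_s16 <;> simp [transEndo, trans_zero, trans_one_zero, trans_zero_one]

/-- The automorphisms `transEndo` assembled into a homomorphism. -/
def transAut (h1 : r * u - s * t = 1) : Multiplicative (ℤ × ℤ) →* MulAut (Sapphire r s t u) where
  toFun x := MonoidHom.toMulEquiv (transEndo h1 x.toAdd) (transEndo h1 (-x.toAdd))
    (by rw [transEndo_comp, neg_add_cancel, transEndo_zero])
    (by rw [transEndo_comp, add_neg_cancel, transEndo_zero])
  map_one' := by
    ext x
    exact DFunLike.congr_fun (transEndo_zero h1) x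
  map_mul' x y := by
    ext z
    exact (DFunLike.congr_fun (transEndo_comp h1 x.toAdd y.toAdd) z).symm

theorem transAut_apply (h1 : r * u - s * t = 1) (x : Multiplicative (ℤ × ℤ))
    (y : Sapphire r s t u) : transAut h1 x y = transEndo h1 x.toAdd y := rfl

/-- The endomorphism inverting `d` and `b` with `v ↦ d^(1-r) b^s v` and `a ↦ d⁻¹a`. -/
def flipEndo (h1 : r * u - s * t = 1) : Sapphire r s t u →* Sapphire r s t u :=
  endo h1 (-1) (-1) 0 (1 - r) s (by ring) (by linear_combination -h1)

theorem flipEndo_comp (h1 : r * u - s * t = 1) :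
    (flipEndo h1).comp (flipEndo h1) = MonoidHom.id (Sapphire r s t u) := by
  apply hom_ext_s16 <;>
    simp only [flipEndo, MonoidHom.comp_apply, endo_v, endo_a, endo_b, endo_d, endo_trans, map_mul,
      ← mul_assoc, trans_mul, MonoidHom.id_apply]
  · simp [trans_zero]
  · simp [trans_zero]
  · simp [trans_zero_one]
  · simp [trans_one_zero]

theorem flipEndo_comp_transEndo (h1 : r * u - s * t = 1) (x : ℤ × ℤ) :
    (flipEndo h1).comp (transEndo h1 x) = (transEndo h1 (-x)).comp (flipEndo h1) := by
  apply hom_ext_s16 <;>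
    simp only [flipEndo, transEndo, MonoidHom.comp_apply, endo_v, endo_a, endo_b, endo_d,
      endo_trans, map_mul, ← mul_assoc, trans_mul, Prod.fst_neg, Prod.snd_neg]
  · congr 2 <;> ring
  · congr 2; ring
  · simp
  · simp

/-- `flipEndo` as an automorphism. -/
def flipAut (h1 : r * u - s * t = 1) : MulAut (Sapphire r s t u) :=
  MonoidHom.toMulEquiv (flipEndo h1) (flipEndo h1) (flipEndo_comp h1) (flipEndo_comp h1)

theorem flipAut_apply (h1 : r * u - s * t = 1) (y : Sapphire r s t u) :
    flipAut h1 y = flipEndo h1 y := rfl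

theorem flipAut_mul_self (h1 : r * u - s * t = 1) : flipAut h1 * flipAut h1 = 1 := by
  ext x
  exact DFunLike.congr_fun (flipEndo_comp h1) x

theorem flipAut_mul_transAut (h1 : r * u - s * t = 1) (x : Multiplicative (ℤ × ℤ)) :
    flipAut h1 * transAut h1 x = transAut h1 x⁻¹ * flipAut h1 := by
  ext y
  exact DFunLike.congr_fun (flipEndo_comp_transEndo h1 x.toAdd) y

theorem mulAut_ext_s16 {φ ψ : MulAut (Sapphire r s t u)} (hv : φ (sapv r s t u) = ψ (sapv r s t u))
    (ha : φ (sapa r s t u) = ψ (sapa r s t u)) (hb : φ (sapb r s t u) = ψ (sapb r s t u))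
    (hd : φ (sapd r s t u) = ψ (sapd r s t u)) : φ = ψ := by
  have : φ.toMonoidHom = ψ.toMonoidHom := hom_ext_s16 hv ha hb hd
  ext x
  exact DFunLike.congr_fun this x

theorem exists_aut_coords (h1 : r * u - s * t = 1) (h0 : r * s * t * u ≠ 0)
    (φ : MulAut (Sapphire r s t u)) (hv : toDihedral (φ (sapv r s t u)) = DihedralGroup.r 1)
    (ha : toDihedral (φ (sapa r s t u)) = DihedralGroup.sr 0) :
    ∃ h₁ h₂ g₁ g₂, (h₁ = 0 ∨ h₁ = -1) ∧ u * g₁ + t * (g₂ - h₂) = -(u - 1) * h₁ ∧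
      φ (sapd r s t u) = trans r s t u (2 * h₁ + 1) 0 ∧
      φ (sapb r s t u) = trans r s t u 0 (2 * h₁ + 1) ∧
      φ (sapv r s t u) = trans r s t u g₁ g₂ * sapv r s t u ∧
      φ (sapa r s t u) = trans r s t u h₁ h₂ * sapa r s t u := by
  obtain ⟨g₁, g₂, hg⟩ := exists_trans_mul h1 (hv.trans toDihedral_v.symm)
  obtain ⟨h₁, h₂, hh⟩ := exists_trans_mul h1 (ha.trans toDihedral_a.symm)
  have hd : φ (sapd r s t u) = trans r s t u (2 * h₁ + 1) 0 := by
    rw [← a_sq, map_pow, hh, trans_mul_a_sq]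
  obtain ⟨q₁, q₂, hb⟩ : ∃ q₁ q₂, φ (sapb r s t u) = trans r s t u q₁ q₂ := by
    rw [← mem_sapDB_iff, aut_mem_iff h1 h0, ← trans_zero_one]
    exact trans_mem r s t u 0 1
  have hq₁ : q₁ = 0 := by
    have h := congrArg φ (a_conj_b (r := r) (s := s) (t := t) (u := u))
    rw [map_mul, map_mul, map_inv, map_inv, hh, hb, a_conj_trans_mul_a, trans_inv] at h
    have := (trans_injective h1 h).1
    omega
  have hφ : ∀ i j, φ (trans r s t u i j) = trans r s t u ((2 * h₁ + 1) * i) (q₂ * j) := by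
    intro i j
    rw [trans, map_mul, map_zpow, map_zpow, hd, hb, trans_zpow, trans_zpow, trans_mul, hq₁]
    congr 1 <;> ring
  have hq₂ : q₂ = 2 * h₁ + 1 := by
    have h := congrArg φ (v_conj_trans r s t u 1 0)
    rw [map_mul, map_mul, map_inv, hg, hφ, hφ, v_conj_trans_mul_v] at h
    have h' := (trans_injective h1 h).2
    have hsu : s * u ≠ 0 := fun h => h0 (by linear_combination (r * t) * h)
    have : s * u * (q₂ - (2 * h₁ + 1)) = 0 := by linarith
    linarith [(mul_eq_zero.1 this).resolve_left hsu]
  subst hq₁ hq₂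
  refine ⟨h₁, h₂, g₁, g₂, ?_, ?_, hd, hb, hg, hh⟩
  · obtain ⟨y, hy⟩ := φ.surjective (sapd r s t u)
    have hyN : y ∈ sapDB r s t u := by
      rw [← aut_mem_iff h1 h0 φ, hy, ← trans_one_zero]
      exact trans_mem r s t u 1 0
    obtain ⟨i, j, rfl⟩ := (mem_sapDB_iff r s t u).1 hyN
    rw [hφ, ← trans_one_zero] at hy
    rcases Int.eq_one_or_neg_one_of_mul_eq_one (trans_injective h1 hy).1 with h | h
    · left; omega
    · right; omega
  · have h := congrArg φ (a_mul_v (r := r) (s := s) (t := t) (u := u))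
    rw [map_mul, map_mul, map_mul, map_inv, hφ, hg, hh, a_conj_v_left, a_conj_v_right h1,
      mul_left_inj] at h
    have h' := (trans_injective h1 h).1
    have hr : r ≠ 0 := fun h => h0 (by rw [h]; ring)
    have : 2 * r * (u * g₁ + t * (g₂ - h₂) + (u - 1) * h₁) = 0 := by
      linear_combination h' + (h₁ + g₁) * h1
    have := (mul_eq_zero.1 this).resolve_left (mul_ne_zero two_ne_zero hr)
    linarith

/-- Automorphisms inducing the identity on the infinite dihedral quotient. -/
theorem exists_eq_transAut (h1 : r * u - s * t = 1) (h0 : r * s * t * u ≠ 0)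
    (φ : MulAut (Sapphire r s t u)) (hv : toDihedral (φ (sapv r s t u)) = DihedralGroup.r 1)
    (ha : toDihedral (φ (sapa r s t u)) = DihedralGroup.sr 0) :
    ∃ x, φ = transAut h1 x ∨ φ = transAut h1 x * flipAut h1 := by
  obtain ⟨h₁, h₂, g₁, g₂, rfl | rfl, hc, hd, hb, hv, ha⟩ := exists_aut_coords h1 h0 φ hv ha
  · refine ⟨Multiplicative.ofAdd (h₂, r * (h₂ - g₂) - s * g₁ - r * h₂), Or.inl ?_⟩
    apply mulAut_ext_s16
    · rw [hv, transAut_apply, transEndo, endo_v]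
      congr 2 <;> rw [toAdd_ofAdd]
      · linear_combination r * hc - g₁ * h1
      · linear_combination (-s) * hc + (h₂ - g₂) * h1
    · rw [ha, transAut_apply, transEndo, endo_a, toAdd_ofAdd]
    · rw [hb, transAut_apply, transEndo, endo_b]; simp
    · rw [hd, transAut_apply, transEndo, endo_d]; simp
  · refine ⟨Multiplicative.ofAdd
      (h₂, r * (h₂ - g₂ + s) - s * (g₁ - 1 + r) - r * h₂), Or.inr ?_⟩
    apply mulAut_ext_s16
    · rw [hv, MulAut.mul_apply, flipAut_apply, transAut_apply, flipEndo, endo_v, map_mul, transEndo,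
        endo_v, endo_trans, ← mul_assoc, trans_mul]
      congr 2 <;> rw [toAdd_ofAdd]
      · linear_combination r * hc - (g₁ - 1) * h1
      · linear_combination (-s) * hc + (h₂ - g₂) * h1
    · rw [ha, MulAut.mul_apply, flipAut_apply, transAut_apply, flipEndo, endo_a, map_mul, transEndo,
        endo_a, endo_trans, ← mul_assoc, trans_mul, toAdd_ofAdd]
      simp
    · rw [hb, MulAut.mul_apply, flipAut_apply, transAut_apply, flipEndo, endo_b, transEndo,
        endo_trans]
      simp
    · rw [hd, MulAut.mul_apply, flipAut_apply, transAut_apply, flipEndo, endo_d, transEndo,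
        endo_trans]
      simp

theorem conj_trans_v (n₁ n₂ : ℤ) :
    trans r s t u n₁ n₂ * sapv r s t u * (trans r s t u n₁ n₂)⁻¹ =
      trans r s t u (n₁ - (r * u + s * t) * n₁ + 2 * r * t * n₂)
        (n₂ - (r * u + s * t) * n₂ + 2 * s * u * n₁) * sapv r s t u := by
  rw [mul_assoc, trans_inv, v_mul_trans, ← mul_assoc, trans_mul]
  congr 2 <;> ring

theorem conj_trans_a (n₁ n₂ : ℤ) :
    trans r s t u n₁ n₂ * sapa r s t u * (trans r s t u n₁ n₂)⁻¹ =
      trans r s t u 0 (2 * n₂) * sapa r s t u := by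
  rw [mul_assoc, trans_inv, a_mul_trans, ← mul_assoc, trans_mul]
  congr 2 <;> ring

theorem transAut_mem_range_iff (h1 : r * u - s * t = 1) (h0 : r * s * t * u ≠ 0) (α β : ℤ) :
    transAut h1 (Multiplicative.ofAdd (α, β)) ∈
      (MulAut.conj : Sapphire r s t u →* MulAut (Sapphire r s t u)).range ↔
      2 ∣ α ∧ 2 * s ∣ β := by
  constructor
  · rintro ⟨x, hx⟩
    have hx' : ∀ y, x * y * x⁻¹ = transEndo h1 (α, β) y := fun y => by
      have := DFunLike.congr_fun hx y
      rwa [MulAut.conj_apply, transAut_apply] at this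
    have hxN : x ∈ sapDB r s t u := by
      refine (mem_of_act_scalar (ε := 1) h1 h0 ?_ ?_).2 <;> rw [hx'] <;>
        simp [transEndo, trans_one_zero, trans_zero_one]
    obtain ⟨n₁, n₂, rfl⟩ := (mem_sapDB_iff r s t u).1 hxN
    have ha := hx' (sapa r s t u)
    have hv := hx' (sapv r s t u)
    rw [conj_trans_a, transEndo, endo_a, mul_left_inj] at ha
    rw [conj_trans_v, transEndo, endo_v, mul_left_inj] at hv
    have ha' := (trans_injective h1 ha).2
    have hv' := (trans_injective h1 hv).1
    refine ⟨⟨n₂, ha'.symm⟩, -n₁, ?_⟩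
    have ht : t ≠ 0 := fun h => h0 (by rw [h]; ring)
    have : t * (β - 2 * s * -n₁) = 0 := by
      simp only at ha' hv'
      linear_combination (-1) * hv' + r * t * ha' - n₁ * h1
    linarith [(mul_eq_zero.1 this).resolve_left ht]
  · rintro ⟨⟨n₂, rfl⟩, ⟨n₁, rfl⟩⟩
    refine ⟨trans r s t u (-n₁) n₂, ?_⟩
    apply mulAut_ext_s16
    · rw [MulAut.conj_apply, conj_trans_v, transAut_apply, transEndo, endo_v]
      congr 2 <;> rw [toAdd_ofAdd]
      · linear_combination n₁ * h1
      · linear_combination n₂ * h1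
    · rw [MulAut.conj_apply, conj_trans_a, transAut_apply, transEndo, endo_a, toAdd_ofAdd]
    · rw [MulAut.conj_apply, transAut_apply, transEndo, endo_b, ← trans_zero_one, trans_inv,
        trans_mul, trans_mul]
      simp
    · rw [MulAut.conj_apply, transAut_apply, transEndo, endo_d, ← trans_one_zero, trans_inv,
        trans_mul, trans_mul]
      simp

theorem transAut_mul_flipAut_notMem_range (h1 : r * u - s * t = 1) (h0 : r * s * t * u ≠ 0)
    (x : Multiplicative (ℤ × ℤ)) : transAut h1 x * flipAut h1 ∉
      (MulAut.conj : Sapphire r s t u →* MulAut (Sapphire r s t u)).range := by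
  rintro ⟨g, hg⟩
  have hg' : ∀ y, g * y * g⁻¹ = transEndo h1 x.toAdd (flipEndo h1 y) := fun y =>
    DFunLike.congr_fun hg y
  have h := (mem_of_act_scalar (ε := -1) (x := g) h1 h0 ?_ ?_).1
  · norm_num at h
  · rw [hg', flipEndo, transEndo, endo_d, endo_trans, ← trans_one_zero, trans_zpow]; simp
  · rw [hg', flipEndo, transEndo, endo_b, endo_trans, ← trans_zero_one, trans_zpow]; simp

end Endomorphisms

end Sapphire

section Involution

/-- The homomorphism from `ℤ/2` determined by an element of order dividing two. -/
def involutionHom {G : Type*} [Group G] (g : G) (hg : g * g = 1) :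
    Multiplicative (ZMod 2) →* G where
  toFun e := if e = 1 then 1 else g
  map_one' := if_pos rfl
  map_mul' := by
    have h : ∀ e : Multiplicative (ZMod 2), e = 1 ∨ e = ofAdd 1 := by decide
    have h2 : (ofAdd 1 * ofAdd 1 : Multiplicative (ZMod 2)) = 1 := by decide
    have h3 : (ofAdd 1 : Multiplicative (ZMod 2)) ≠ 1 := by decide
    intro x y
    rcases h x with rfl | rfl <;> rcases h y with rfl | rfl <;> simp [h2, h3, hg]

theorem involutionHom_one {G : Type*} [Group G] (g : G) (hg : g * g = 1) :
    involutionHom g hg (ofAdd 1) = g := by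
  have h : (ofAdd 1 : Multiplicative (ZMod 2)) ≠ 1 := by decide
  exact if_neg (t := (1 : G)) h

theorem eq_one_or_eq_ofAdd_one (e : Multiplicative (ZMod 2)) : e = 1 ∨ e = ofAdd 1 := by
  revert e; decide

/-- The action of `ℤ/2` on a commutative group by inversion. -/
def inversionAction (A : Type*) [CommGroup A] : Multiplicative (ZMod 2) →* MulAut A :=
  involutionHom (MulEquiv.inv A) (by ext x; exact inv_inv x)

theorem inversionAction_one {A : Type*} [CommGroup A] (x : A) :
    inversionAction A (ofAdd 1) x = x⁻¹ := by
  rw [inversionAction, involutionHom_one]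
  rfl

/-- A homomorphism of commutative groups induces one of generalized dihedral groups. -/
def inversionMap {A B : Type*} [CommGroup A] [CommGroup B] (f : A →* B) :
    A ⋊[inversionAction A] Multiplicative (ZMod 2) →*
      B ⋊[inversionAction B] Multiplicative (ZMod 2) :=
  SemidirectProduct.map f (MonoidHom.id _) (by
    intro e
    ext x
    rcases eq_one_or_eq_ofAdd_one e with rfl | rfl
    · simp
    · simp [inversionAction_one])

/-- Reduction of the integral lattice modulo `2` and `n`. -/
def reduction (n : ℕ) : Multiplicative (ℤ × ℤ) →* Multiplicative (ZMod 2 × ZMod n) :=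
  AddMonoidHom.toMultiplicative
    ((Int.castAddHom (ZMod 2)).prodMap (Int.castAddHom (ZMod n)))

theorem reduction_surjective (n : ℕ) : Function.Surjective (reduction n) := by
  intro x
  obtain ⟨i, hi⟩ := ZMod.intCast_surjective x.toAdd.1
  obtain ⟨j, hj⟩ := ZMod.intCast_surjective x.toAdd.2
  exact ⟨ofAdd (i, j), Prod.ext hi hj⟩

theorem reduction_eq_one_iff (n : ℕ) (i j : ℤ) :
    reduction n (ofAdd (i, j)) = 1 ↔ 2 ∣ i ∧ (n : ℤ) ∣ j := by
  rw [← ZMod.intCast_zmod_eq_zero_iff_dvd, ← Nat.cast_two (R := ℤ),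
    ← ZMod.intCast_zmod_eq_zero_iff_dvd]
  exact Prod.ext_iff

end Involution

namespace Sapphire

variable {r s t u : ℤ}

/-- The subgroup generated by `transAut` and `flipAut`, as the image of a generalized dihedral
group. -/
def dihedralAut (h1 : r * u - s * t = 1) :
    Multiplicative (ℤ × ℤ) ⋊[inversionAction _] Multiplicative (ZMod 2) →*
      MulAut (Sapphire r s t u) :=
  SemidirectProduct.lift (transAut h1) (involutionHom (flipAut h1) (flipAut_mul_self h1)) (by
    intro e
    refine MonoidHom.ext fun x => ?_
    rcases eq_one_or_eq_ofAdd_one e with rfl | rfl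
    · simp
    · simp only [MonoidHom.comp_apply, MulEquiv.coe_toMonoidHom, inversionAction_one,
        involutionHom_one, MulAut.conj_apply]
      rw [flipAut_mul_transAut, mul_inv_cancel_right])

theorem dihedralAut_mem_range_iff (h1 : r * u - s * t = 1) (h0 : r * s * t * u ≠ 0)
    (x : Multiplicative (ℤ × ℤ) ⋊[inversionAction _] Multiplicative (ZMod 2)) :
    dihedralAut h1 x ∈ (MulAut.conj : Sapphire r s t u →* MulAut (Sapphire r s t u)).range ↔
      inversionMap (reduction (2 * s.natAbs)) x = 1 := by
  obtain ⟨x, e⟩ := x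
  rw [SemidirectProduct.mk_eq_inl_mul_inr, dihedralAut, map_mul, SemidirectProduct.lift_inl,
    SemidirectProduct.lift_inr, inversionMap, map_mul, SemidirectProduct.map_inl,
    SemidirectProduct.map_inr, ← SemidirectProduct.mk_eq_inl_mul_inr]
  rcases eq_one_or_eq_ofAdd_one e with rfl | rfl
  · have hs : ((2 * s.natAbs : ℕ) : ℤ) ∣ x.toAdd.2 ↔ 2 * s ∣ x.toAdd.2 := by
      rw [← Int.natAbs_dvd (a := 2 * s), Int.natAbs_mul]
      rfl
    rw [map_one, mul_one, ← ofAdd_toAdd x, transAut_mem_range_iff h1 h0, ← hs,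
      ← reduction_eq_one_iff]
    simp [SemidirectProduct.ext_iff]
  · rw [involutionHom_one]
    refine iff_of_false (transAut_mul_flipAut_notMem_range h1 h0 x) fun h => ?_
    have h' : (ofAdd 1 : Multiplicative (ZMod 2)) = 1 := congrArg SemidirectProduct.right h
    exact absurd h' (by decide)

theorem exists_dihedralAut_mk_eq (h1 : r * u - s * t = 1) (h0 : r * s * t * u ≠ 0)
    (hempty : ¬ ∃ φ : MulAut (Sapphire r s t u),
      (sapDB r s t u).map φ.toMonoidHom = sapDB r s t u ∧
      (∃ g ∈ sapDB r s t u, φ (sapv r s t u) = g * sapv r s t u) ∧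
      (∃ g ∈ sapDB r s t u, φ (sapa r s t u) = g * sapv r s t u * sapa r s t u)) :
    Function.Surjective ((QuotientGroup.mk'
      (MulAut.conj : Sapphire r s t u →* MulAut (Sapphire r s t u)).range).comp
        (dihedralAut h1)) := by
  intro y
  obtain ⟨φ, rfl⟩ := QuotientGroup.mk'_surjective _ y
  obtain ⟨g, hv, ha⟩ := exists_conj_toDihedral_trivial h1 h0 hempty φ
  have hg : QuotientGroup.mk' (MulAut.conj : Sapphire r s t u →* _).range (MulAut.conj g) = 1 :=
    (QuotientGroup.eq_one_iff _).2 (MonoidHom.mem_range.2 ⟨g, rfl⟩)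
  have hφ : QuotientGroup.mk' (MulAut.conj : Sapphire r s t u →* _).range φ =
      QuotientGroup.mk' _ (MulAut.conj g * φ) := by
    rw [map_mul, hg, one_mul]
  obtain ⟨x, hx | hx⟩ := exists_eq_transAut h1 h0 _ hv ha
  · exact ⟨SemidirectProduct.inl x, by rw [hφ, hx]; simp [dihedralAut]⟩
  · exact ⟨SemidirectProduct.inl x * SemidirectProduct.inr (ofAdd 1), by
      rw [hφ, hx]; simp [dihedralAut, involutionHom_one]⟩

end Sapphire

/-- If `Aut₀¹(E) = ∅`, i.e. no automorphism `φ` of the sapphire group maps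
`⟨d, b⟩` onto itself with `φ(v) ∈ ⟨d, b⟩ · v` and `φ(a) ∈ ⟨d, b⟩ · v · a`, then
`Out(E) ≅ (ℤ/2 × ℤ/2|s|) ⋊ ℤ/2`, the nontrivial element of `ℤ/2` acting by inversion. -/
theorem stmt16 (r s t u : ℤ) (h1 : r * u - s * t = 1) (h0 : r * s * t * u ≠ 0)
    (hempty : ¬ ∃ φ : MulAut (Sapphire r s t u),
      (sapDB r s t u).map φ.toMonoidHom = sapDB r s t u ∧
      (∃ g ∈ sapDB r s t u, φ (sapv r s t u) = g * sapv r s t u) ∧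
      (∃ g ∈ sapDB r s t u, φ (sapa r s t u) = g * sapv r s t u * sapa r s t u)) :
    ∃ ψ : Multiplicative (ZMod 2) →*
        MulAut (Multiplicative (ZMod 2 × ZMod (2 * s.natAbs))),
      (∀ x : Multiplicative (ZMod 2 × ZMod (2 * s.natAbs)), ψ (Multiplicative.ofAdd 1) x = x⁻¹) ∧
      Nonempty ((OutG (Sapphire r s t u)) ≃*
        (Multiplicative (ZMod 2 × ZMod (2 * s.natAbs)) ⋊[ψ] Multiplicative (ZMod 2))) := by
  refine ⟨inversionAction _, inversionAction_one, ?_⟩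
  have hsurj : Function.Surjective (inversionMap (reduction (2 * s.natAbs))) := fun y => by
    obtain ⟨x, hx⟩ := reduction_surjective _ y.left
    exact ⟨⟨x, y.right⟩, SemidirectProduct.ext hx rfl⟩
  have hker : ((QuotientGroup.mk' (MulAut.conj : Sapphire r s t u →* _).range).comp
      (Sapphire.dihedralAut h1)).ker = (inversionMap (reduction (2 * s.natAbs))).ker := by
    ext x
    rw [MonoidHom.mem_ker, MonoidHom.mem_ker, MonoidHom.comp_apply, QuotientGroup.mk'_apply,
      QuotientGroup.eq_one_iff, Sapphire.dihedralAut_mem_range_iff h1 h0]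
  exact ⟨(QuotientGroup.quotientKerEquivOfSurjective _
    (Sapphire.exists_dihedralAut_mk_eq h1 h0 hempty)).symm.trans
    ((QuotientGroup.quotientMulEquivOfEq hker).trans
      (QuotientGroup.quotientKerEquivOfSurjective _ hsurj))⟩
end

section
/- Let A ∈ GL(2,ℤ) be an Anosov matrix and let B ∈ GL(2,ℤ) satisfy B·A·B⁻¹ = A⁻¹. Then B² = I or B² = −I, and moreover B ≠ −I. -/
open Matrix SemidirectProduct Multiplicative

/-- A matrix in `GL(2,ℤ)` is exceptional if `det = 1` and `|tr| ≤ 2`, or `det = -1` and `tr = 0`. -/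
def IsExceptional (A : GL2Z) : Prop :=
  ((A : Matrix (Fin 2) (Fin 2) ℤ).det = 1 ∧ |(A : Matrix (Fin 2) (Fin 2) ℤ).trace| ≤ 2) ∨
    ((A : Matrix (Fin 2) (Fin 2) ℤ).det = -1 ∧ (A : Matrix (Fin 2) (Fin 2) ℤ).trace = 0)

/-- Anosov = not exceptional. -/
def IsAnosov (A : GL2Z) : Prop := ¬ IsExceptional A

/-- If `B * A = adj(A) * B` with `det A = 1` and `|tr A| > 2`, then `tr B = 0`. -/
theorem trace_eq_zero_of_mul_eq_adjugate_mul {A B : Matrix (Fin 2) (Fin 2) ℤ}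
    (hdet : A.det = 1) (htr : 2 < |A.trace|) (h : B * A = A.adjugate * B) : B.trace = 0 := by
  have h00 := congrFun (congrFun h 0) 0
  have h01 := congrFun (congrFun h 0) 1
  have h10 := congrFun (congrFun h 1) 0
  have h11 := congrFun (congrFun h 1) 1
  simp only [adjugate_fin_two, mul_apply, Fin.sum_univ_two, of_apply, cons_val_zero,
    cons_val_one] at h00 h01 h10 h11
  rw [det_fin_two] at hdet
  rw [trace_fin_two] at htr ⊢
  by_contra hB
  have hb : A 0 1 = 0 := (mul_eq_zero.mp (by linear_combination h01 :
    A 0 1 * (B 0 0 + B 1 1) = 0)).resolve_right hB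
  have hc : A 1 0 = 0 := (mul_eq_zero.mp (by linear_combination h10 :
    A 1 0 * (B 0 0 + B 1 1) = 0)).resolve_right hB
  rw [hb, hc] at h00 h11
  have had : A 0 0 - A 1 1 = 0 := (mul_eq_zero.mp (by linear_combination h00 - h11 :
    (A 0 0 - A 1 1) * (B 0 0 + B 1 1) = 0)).resolve_right hB
  have hsq : A 1 1 * A 1 1 = 1 := by
    rw [hb, sub_eq_zero.mp had] at hdet
    linear_combination hdet
  rcases mul_self_eq_one_iff.mp hsq with h1 | h1 <;>
    rw [sub_eq_zero.mp had, h1] at htr <;> norm_num at htr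

/-- Cayley-Hamilton for a traceless `2 × 2` matrix. -/
theorem sq_eq_neg_det_smul_one_of_trace_eq_zero {R : Type*} [CommRing R]
    {B : Matrix (Fin 2) (Fin 2) R} (h : B.trace = 0) : B ^ 2 = (-B.det) • 1 := by
  rw [trace_fin_two] at h
  rw [det_fin_two, sq]
  ext i j
  fin_cases i <;> fin_cases j <;> simp [mul_apply, Fin.sum_univ_two]
  · linear_combination B 0 0 * h
  · linear_combination B 0 1 * h
  · linear_combination B 1 0 * h
  · linear_combination B 1 1 * h

/-- If `A` is Anosov and `B * A * B⁻¹ = A⁻¹` in `GL(2,ℤ)`, then `B² = ±I`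
and `B ≠ -I`. -/
theorem stmt17 (A B : GL2Z) (hA : IsAnosov A) (hB : B * A * B⁻¹ = A⁻¹) :
    (B ^ 2 = 1 ∨ B ^ 2 = -1) ∧ B ≠ -1 := by
  have hinv : ((A⁻¹ : GL2Z) : Matrix (Fin 2) (Fin 2) ℤ) =
      Ring.inverse (A : Matrix (Fin 2) (Fin 2) ℤ).det • (A : Matrix (Fin 2) (Fin 2) ℤ).adjugate := by
    rw [coe_units_inv, inv_def]
  have htr : ((A⁻¹ : GL2Z) : Matrix (Fin 2) (Fin 2) ℤ).trace =
      (A : Matrix (Fin 2) (Fin 2) ℤ).trace := by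
    rw [← hB, Units.val_mul, Units.val_mul, trace_units_conj]
  have hdet : (A : Matrix (Fin 2) (Fin 2) ℤ).det = 1 := by
    rcases Int.isUnit_iff.mp ((isUnit_iff_isUnit_det _).mp A.isUnit) with h | h
    · exact h
    · refine absurd (Or.inr ⟨h, ?_⟩) hA
      have hneg : Ring.inverse (-1 : ℤ) = -1 := Ring.inverse_unit (-1 : ℤˣ)
      rw [hinv, h, hneg, trace_smul, trace_fin_two, trace_fin_two, adjugate_fin_two] at htr
      rw [trace_fin_two]
      simp at htr
      linarith
  rw [hdet, Ring.inverse_one, one_smul] at hinv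
  have hlarge : 2 < |(A : Matrix (Fin 2) (Fin 2) ℤ).trace| :=
    not_le.mp fun h => hA (Or.inl ⟨hdet, h⟩)
  have hmul : (B : Matrix (Fin 2) (Fin 2) ℤ) * A =
      (A : Matrix (Fin 2) (Fin 2) ℤ).adjugate * B := by
    rw [← hinv, ← Units.val_mul, ← Units.val_mul, mul_inv_eq_iff_eq_mul.mp hB]
  have hzero := trace_eq_zero_of_mul_eq_adjugate_mul hdet hlarge hmul
  refine ⟨?_, ?_⟩
  · have hsq := sq_eq_neg_det_smul_one_of_trace_eq_zero hzero
    rcases Int.isUnit_iff.mp ((isUnit_iff_isUnit_det _).mp B.isUnit) with h | h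
    · right
      ext1
      simpa [h] using hsq
    · left
      ext1
      simpa [h] using hsq
  · rintro rfl
    simp at hzero
end

section
/- Let A ∈ GL(2,ℤ) be a matrix of infinite order and let B ∈ GL(2,ℤ) be a matrix of finite order such that B·A·B⁻¹ = A⁻¹. Then B is conjugate in GL(2,ℤ) to one of the three matrices [[0, −1], [1, 0]], [[1, 0], [0, −1]], [[1, 1], [0, −1]] (which have orders 4, 2 and 2 respectively). -/
open Matrix SemidirectProduct Multiplicative

/-- `[[0, -1], [1, 0]]` as an element of `GL(2,ℤ)`. -/
def B₁ : GL2Z :=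
  ⟨!![0, -1; 1, 0], !![0, 1; -1, 0],
    by decide,
    by decide⟩

/-- `[[1, 0], [0, -1]]` as an element of `GL(2,ℤ)`. -/
def B₂ : GL2Z :=
  ⟨!![1, 0; 0, -1], !![1, 0; 0, -1],
    by decide,
    by decide⟩

/-- `[[1, 1], [0, -1]]` as an element of `GL(2,ℤ)`. -/
def B₃ : GL2Z :=
  ⟨!![1, 1; 0, -1], !![1, 1; 0, -1],
    by decide,
    by decide⟩

/-- Two integer matrices are intertwined by an element of `GL(2,ℤ)`. -/
def IsIntConj (M N : Matrix (Fin 2) (Fin 2) ℤ) : Prop :=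
  ∃ P : GL2Z, (P : Matrix (Fin 2) (Fin 2) ℤ) * M = N * P

theorem IsIntConj.trans {M N K : Matrix (Fin 2) (Fin 2) ℤ} (h : IsIntConj M N)
    (h' : IsIntConj N K) : IsIntConj M K := by
  obtain ⟨P, hP⟩ := h
  obtain ⟨Q, hQ⟩ := h'
  refine ⟨Q * P, ?_⟩
  rw [Units.val_mul, mul_assoc, hP, ← mul_assoc, hQ, mul_assoc]

theorem IsIntConj.of_det {M N : Matrix (Fin 2) (Fin 2) ℤ} (P : Matrix (Fin 2) (Fin 2) ℤ)
    (hP : P.det = 1 ∨ P.det = -1) (h : P * M = N * P) : IsIntConj M N :=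
  ⟨GeneralLinearGroup.mk'' P (Int.isUnit_iff.2 hP), h⟩

/-- Conjugation of a traceless matrix by an upper unipotent matrix. -/
theorem isIntConj_shear_upper (a b c n : ℤ) :
    IsIntConj !![a, b; c, -a]
      !![a + n * c, b - 2 * n * a - n ^ 2 * c; c, -(a + n * c)] := by
  refine .of_det !![1, n; 0, 1] (by simp [det_fin_two]) ?_
  ext i j
  fin_cases i <;> fin_cases j <;> simp [mul_apply, Fin.sum_univ_two] <;> ring

/-- Conjugation of a traceless matrix by the coordinate swap. -/
theorem isIntConj_swap (a b c : ℤ) : IsIntConj !![a, b; c, -a] !![-a, c; b, -(-a)] := by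
  refine .of_det !![0, 1; 1, 0] (by simp [det_fin_two]) ?_
  ext i j
  fin_cases i <;> fin_cases j <;> simp [mul_apply, Fin.sum_univ_two]

/-- The matrix is intertwined with one of the three normal forms. -/
def HasNormalForm (M : Matrix (Fin 2) (Fin 2) ℤ) : Prop :=
  IsIntConj M B₁.val ∨ IsIntConj M B₂.val ∨ IsIntConj M B₃.val

theorem HasNormalForm.of_isIntConj {M N : Matrix (Fin 2) (Fin 2) ℤ} (hN : HasNormalForm N)
    (h : IsIntConj M N) : HasNormalForm M :=
  hN.imp h.trans (Or.imp h.trans h.trans)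

theorem hasNormalForm_upper (a b : ℤ) (ha : a = 1 ∨ a = -1) :
    HasNormalForm !![a, b; 0, -a] := by
  obtain ⟨k, hk | hk⟩ := Int.even_or_odd' b <;> subst hk <;> rcases ha with rfl | rfl
  · refine .inr (.inl (.of_det !![1, k; 0, 1] (by simp [det_fin_two]) ?_))
    ext i j
    fin_cases i <;> fin_cases j <;> simp [mul_apply, Fin.sum_univ_two, B₂]
    ring
  · refine .inr (.inl (.of_det !![0, 1; 1, -k] (by simp [det_fin_two]) ?_))
    ext i j
    fin_cases i <;> fin_cases j <;> simp [mul_apply, Fin.sum_univ_two, B₂]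
    ring
  · refine .inr (.inr (.of_det !![1, k; 0, 1] (by simp [det_fin_two]) ?_))
    ext i j
    fin_cases i <;> fin_cases j <;> simp [mul_apply, Fin.sum_univ_two, B₃]
    ring
  · refine .inr (.inr (.of_det !![1, -k; -2, 2 * k + 1] (.inl (by rw [det_fin_two_of]; ring)) ?_))
    ext i j
    fin_cases i <;> fin_cases j <;> simp [mul_apply, Fin.sum_univ_two, B₃] <;> ring

theorem hasNormalForm_antidiagonal (b c : ℤ) (h : b * c = 1 ∨ b * c = -1) :
    HasNormalForm !![0, b; c, -0] := by
  rcases h with h | h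
  · refine .inr (.inr ?_)
    rcases Int.mul_eq_one_iff_eq_one_or_neg_one.1 h with ⟨rfl, rfl⟩ | ⟨rfl, rfl⟩
    · exact .of_det !![0, 1; 1, -1] (by decide) (by decide)
    · exact .of_det !![0, -1; 1, 1] (by decide) (by decide)
  · refine .inl ?_
    rcases Int.mul_eq_neg_one_iff_eq_one_or_neg_one.1 h with ⟨rfl, rfl⟩ | ⟨rfl, rfl⟩
    · exact .of_det !![1, 0; 0, -1] (by decide) (by decide)
    · exact .of_det !![1, 0; 0, 1] (by decide) (by decide)

theorem Int.exists_natAbs_add_mul_lt {a c : ℤ} (hc : c ≠ 0) (h : |c| < 2 * |a|) :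
    ∃ n : ℤ, (a + n * c).natAbs < a.natAbs := by
  by_cases hs : (a + c).natAbs < a.natAbs
  · exact ⟨1, by simpa using hs⟩
  · exact ⟨-1, by rw [neg_one_mul]; grind⟩

/-- Reduction of a traceless integer matrix of determinant `±1`. -/
theorem hasNormalForm_traceless (a b c : ℤ) (h : a ^ 2 + b * c = 1 ∨ a ^ 2 + b * c = -1) :
    HasNormalForm !![a, b; c, -a] := by
  induction hm : a.natAbs using Nat.strong_induction_on generalizing a b c with
  | _ m ih =>
  subst hm
  have upper (a b c : ℤ) (h : a ^ 2 + b * c = 1 ∨ a ^ 2 + b * c = -1)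
      (ih : ∀ a' b' c' : ℤ, (a' ^ 2 + b' * c' = 1 ∨ a' ^ 2 + b' * c' = -1) →
        a'.natAbs < a.natAbs → HasNormalForm !![a', b'; c', -a'])
      (hc : |c| < 2 * |a|) : HasNormalForm !![a, b; c, -a] := by
    by_cases hc0 : c = 0
    · subst hc0
      refine hasNormalForm_upper a b (eq_or_eq_neg_of_sq_eq_sq a 1 ?_)
      rcases h with h | h <;> nlinarith [sq_nonneg a]
    · obtain ⟨n, hn⟩ := Int.exists_natAbs_add_mul_lt hc0 hc
      refine (ih _ _ _ ?_ hn).of_isIntConj (isIntConj_shear_upper a b c n)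
      convert h using 2 <;> ring
  have ih' (a' b' c' : ℤ) (h' : a' ^ 2 + b' * c' = 1 ∨ a' ^ 2 + b' * c' = -1)
      (hlt : a'.natAbs < a.natAbs) : HasNormalForm !![a', b'; c', -a'] :=
    ih _ hlt a' b' c' h' rfl
  by_cases hc : |c| < 2 * |a|
  · exact upper a b c h ih' hc
  by_cases hb : |b| < 2 * |a|
  · refine (upper (-a) c b ?_ ?_ ?_).of_isIntConj (isIntConj_swap a b c)
    · rwa [neg_sq, mul_comm c b]
    · simpa using ih'
    · rwa [abs_neg]
  · have hbc : 4 * a ^ 2 ≤ |b * c| := by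
      rw [abs_mul, ← sq_abs a]
      nlinarith [abs_nonneg a]
    have ha : a = 0 := by
      have hle : |b * c| ≤ a ^ 2 + 1 := by
        rw [abs_le]
        constructor <;> rcases h with h | h <;> nlinarith [sq_nonneg a]
      have : a ^ 2 < 1 := by linarith
      exact pow_eq_zero_iff two_ne_zero |>.1 (by nlinarith [sq_nonneg a])
    subst ha
    exact hasNormalForm_antidiagonal b c (by simpa using h)

/-- An invertible matrix inverting a non-involution has trace zero. -/
theorem trace_eq_zero_of_conj_eq_inv (A B : GL2Z) (hA : A ^ 2 ≠ 1)
    (hconj : B * A * B⁻¹ = A⁻¹) : B.val.trace = 0 := by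
  have hBA : B.val * A.val = A⁻¹.val * B.val := by
    rw [← Units.val_mul, ← Units.val_mul, ← hconj]
    simp
  have hA' : A.val * A.val ≠ 1 := fun h => hA (Units.ext (by simpa [sq] using h))
  have htr : A⁻¹.val.trace = A.val.trace := by
    rw [← hconj, Units.val_mul, Units.val_mul, trace_mul_comm, ← mul_assoc, ← Units.val_mul]
    simp
  have hdet : A.val.det = 1 ∨ A.val.det = -1 :=
    Int.isUnit_iff.1 ((isUnit_iff_isUnit_det _).1 A.isUnit)
  have hadj : A.val.adjugate = A.val.det • A⁻¹.val := by
    have := congrArg (· * A⁻¹.val) (adjugate_mul A.val)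
    simpa [mul_assoc] using this
  generalize A.val = X at *
  generalize A⁻¹.val = Y at *
  generalize B.val = Z at *
  by_contra hZ
  apply hA'
  rw [X.adjugate_fin_two] at hadj
  rw [← Matrix.ext_iff] at *
  simp only [Fin.forall_fin_two, mul_apply, Fin.sum_univ_two, Matrix.smul_apply, trace_fin_two,
    of_apply, cons_val', cons_val_zero, cons_val_one, cons_val_fin_one, one_apply_eq,
    smul_eq_mul, ne_eq, zero_ne_one, one_ne_zero, not_false_eq_true, one_apply_ne, det_fin_two] at *
  generalize X 0 0 = x at *
  generalize X 0 1 = y at *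
  generalize X 1 0 = z at *
  generalize X 1 1 = w at *
  obtain ⟨⟨h1, h2⟩, h3, h4⟩ := hBA
  rcases hdet with hd | hd <;> rw [hd] at hadj
  · have hy : y * (Z 0 0 + Z 1 1) = 0 := by grind
    have hz : z * (Z 0 0 + Z 1 1) = 0 := by grind
    obtain rfl := (mul_eq_zero_iff_right hZ).1 hy
    obtain rfl := (mul_eq_zero_iff_right hZ).1 hz
    have hxw : (x - w) * (Z 0 0 + Z 1 1) = 0 := by grind
    obtain rfl := sub_eq_zero.1 ((mul_eq_zero_iff_right hZ).1 hxw)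
    simpa using hd
  · obtain rfl : w = -x := by grind
    refine ⟨⟨?_, ?_⟩, ?_, ?_⟩ <;> linarith

/-- If `A ∈ GL(2,ℤ)` has infinite order, `B ∈ GL(2,ℤ)` has finite order and
`B A B⁻¹ = A⁻¹`, then `B` is conjugate in `GL(2,ℤ)` to one of `[[0,-1],[1,0]]`,
`[[1,0],[0,-1]]`, `[[1,1],[0,-1]]`, which have orders 4, 2 and 2 respectively. -/
theorem stmt19 (A B : GL2Z) (hA : ∀ n : ℕ, 1 ≤ n → A ^ n ≠ 1)
    (hB : ∃ n : ℕ, 1 ≤ n ∧ B ^ n = 1) (hconj : B * A * B⁻¹ = A⁻¹) :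
    (∃ P : GL2Z, P * B * P⁻¹ = B₁ ∨ P * B * P⁻¹ = B₂ ∨ P * B * P⁻¹ = B₃) ∧
    orderOf B₁ = 4 ∧ orderOf B₂ = 2 ∧ orderOf B₃ = 2 := by
  refine ⟨?_, ?_, ?_, ?_⟩
  · have htr := trace_eq_zero_of_conj_eq_inv A B (hA 2 one_le_two) hconj
    have hdet : B.val.det = 1 ∨ B.val.det = -1 :=
      Int.isUnit_iff.1 ((isUnit_iff_isUnit_det _).1 B.isUnit)
    have h11 : B.val 1 1 = -B.val 0 0 := by
      rw [trace_fin_two] at htr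
      linarith
    have hB' := hasNormalForm_traceless (B.val 0 0) (B.val 0 1) (B.val 1 0) (by
      rw [det_fin_two, h11] at hdet
      rcases hdet with h | h
      · exact .inr (by linarith)
      · exact .inl (by linarith))
    rw [← h11, ← eta_fin_two B.val] at hB'
    have lift (N : GL2Z) (h : IsIntConj B.val N.val) : ∃ P : GL2Z, P * B * P⁻¹ = N := by
      obtain ⟨P, hP⟩ := h
      exact ⟨P, mul_inv_eq_of_eq_mul (Units.ext hP)⟩
    rcases hB' with h | h | h
    · exact (lift _ h).imp fun _ => .inl
    · exact (lift _ h).imp fun _ h => .inr (.inl h)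
    · exact (lift _ h).imp fun _ h => .inr (.inr h)
  · exact orderOf_eq_prime_pow (p := 2) (n := 1) (by decide) (by decide)
  · exact orderOf_eq_prime (by decide) (by decide)
  · exact orderOf_eq_prime (by decide) (by decide)
end
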